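/- arXiv:2508.01349 — 3 statements merged into one kernel-verified Lean document; each statement's English description precedes it below -/
import Mathlib

section
/- Let G be a polyhedron having a vertex u of eccentricity 1 (i.e., u is adjacent to all other vertices). Then G has at least two vertices of degree 3. -/
open SimpleGraph

/-- `H` is a minor of `G`: branch-set definition. -/
def SimpleGraph.HasMinor {V W : Type*} (G : SimpleGraph V) (H : SimpleGraph W) : Prop :=
  ∃ f : W → Set V,
    (∀ w, (G.induce (f w)).Connected) ∧
    (Pairwise fun w₁ w₂ => Disjoint (f w₁) (f w₂)) ∧
    ∀ ⦃w₁ w₂⦄, H.Adj w₁ w₂ → ∃ v₁ ∈ f w₁, ∃ v₂ ∈ f w₂, G.Adj v₁ v₂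

/-- Planarity à la Wagner: no `K₅` minor and no `K₃,₃` minor. -/
def SimpleGraph.IsPlanar {V : Type*} (G : SimpleGraph V) : Prop :=
  ¬ G.HasMinor (completeGraph (Fin 5)) ∧
  ¬ G.HasMinor (completeBipartiteGraph (Fin 3) (Fin 3))

/-- `G` is `k`-connected: it has at least `k + 1` vertices, and removing fewer
than `k` vertices always leaves a connected graph. -/
def SimpleGraph.IsKConnected {V : Type*} [Fintype V] (k : ℕ) (G : SimpleGraph V) : Prop :=
  k + 1 ≤ Fintype.card V ∧
  ∀ S : Set V, S.ncard < k → ((⊤ : G.Subgraph).deleteVerts S).coe.Connected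

/-- A polyhedron is a planar, 3-connected (finite simple) graph. -/
def SimpleGraph.IsPolyhedron {V : Type*} [Fintype V] (G : SimpleGraph V) : Prop :=
  G.IsPlanar ∧ G.IsKConnected 3

/-- `A(G)`: the set of numbers of common neighbours of pairs of distinct vertices. -/
def SimpleGraph.commA {V : Type*} (G : SimpleGraph V) : Set ℕ :=
  {a | ∃ u v : V, u ≠ v ∧ (G.commonNeighbors u v).ncard = a}

namespace SimpleGraph

variable {W : Type*} {H : SimpleGraph W} {S T K L A B : Set W} {a b p q r x : W}

/-- Some edge joins the set `S` to the set `T`. -/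
def Touches (H : SimpleGraph W) (S T : Set W) : Prop :=
  ∃ s ∈ S, ∃ t ∈ T, H.Adj s t

/-- `S` is nonempty and every cut of `S` into two nonempty parts is crossed by an edge. -/
def CutConnected (H : SimpleGraph W) (S : Set W) : Prop :=
  S.Nonempty ∧ ∀ T : Set W, ∀ a ∈ S, a ∈ T → ∀ b ∈ S, b ∉ T →
    ∃ s ∈ S, s ∈ T ∧ ∃ t ∈ S, t ∉ T ∧ H.Adj s t

/-- `K` is a connected component of the subgraph induced on `S`. -/
def IsComponentOf (H : SimpleGraph W) (K S : Set W) : Prop :=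
  H.CutConnected K ∧ K ⊆ S ∧ ∀ k ∈ K, ∀ y ∈ S, H.Adj k y → y ∈ K

/-- Four disjoint connected sets that pairwise touch. -/
def HasK4Model (H : SimpleGraph W) : Prop :=
  ∃ A B C D : Set W,
    (H.CutConnected A ∧ H.CutConnected B ∧ H.CutConnected C ∧ H.CutConnected D) ∧
    (Disjoint A B ∧ Disjoint A C ∧ Disjoint A D ∧ Disjoint B C ∧ Disjoint B D ∧ Disjoint C D) ∧
    H.Touches A B ∧ H.Touches A C ∧ H.Touches A D ∧ H.Touches B C ∧ H.Touches B D ∧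
    H.Touches C D

theorem Touches.symm (h : H.Touches S T) : H.Touches T S := by
  obtain ⟨s, hs, t, ht, h⟩ := h
  exact ⟨t, ht, s, hs, h.symm⟩

theorem Touches.mono {S' T' : Set W} (h : H.Touches S T) (hS : S ⊆ S') (hT : T ⊆ T') :
    H.Touches S' T' := by
  obtain ⟨s, hs, t, ht, h⟩ := h
  exact ⟨s, hS hs, t, hT ht, h⟩

theorem cutConnected_singleton (x : W) : H.CutConnected {x} :=
  ⟨⟨x, rfl⟩, by grind⟩

theorem CutConnected.union (hS : H.CutConnected S) (hT : H.CutConnected T)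
    (h : H.Touches S T) : H.CutConnected (S ∪ T) := by
  refine ⟨hS.1.mono Set.subset_union_left, fun U c hc hcU d hd hdU => ?_⟩
  have hS' := hS.2 U
  have hT' := hT.2 U
  obtain ⟨s, hs, t, ht, hst⟩ := h
  have := hst.symm
  grind

theorem CutConnected.touches_diff (hS : H.CutConnected S) (hTS : T ⊆ S) (hT : T.Nonempty)
    (hd : x ∈ S) (hx : x ∉ T) : H.Touches T (S \ T) := by
  obtain ⟨y, hy⟩ := hT
  obtain ⟨s, -, hs, t, ht, htT, h⟩ := hS.2 T y (hTS hy) hy x hd hx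
  exact ⟨s, hs, t, ⟨ht, htT⟩, h⟩

theorem CutConnected.induce_connected (hS : H.CutConnected S) : (H.induce S).Connected := by
  obtain ⟨⟨r, hr⟩, hcut⟩ := hS
  have : Nonempty S := ⟨⟨r, hr⟩⟩
  suffices h : ∀ y : S, (H.induce S).Reachable ⟨r, hr⟩ y from
    ⟨fun y z => (h y).symm.trans (h z)⟩
  by_contra! hy
  obtain ⟨y, hy⟩ := hy
  obtain ⟨-, -, ⟨s, hs, rfl⟩, t, ht, htR, hst⟩ :=
    hcut (Subtype.val '' {y : S | (H.induce S).Reachable ⟨r, hr⟩ y}) r hr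
      ⟨⟨r, hr⟩, Reachable.refl _, rfl⟩ y y.2
      (by rintro ⟨y', hy', h⟩; exact hy (Subtype.ext h ▸ hy'))
  have hadj : (H.induce S).Adj s ⟨t, ht⟩ := hst
  exact htR ⟨⟨t, ht⟩, Reachable.trans hs hadj.reachable, rfl⟩

theorem Connected.cutConnected_univ (h : H.Connected) : H.CutConnected Set.univ := by
  have := h.nonempty
  refine ⟨Set.univ_nonempty, fun T a _ ha b _ hb => ?_⟩
  obtain ⟨w⟩ := h.preconnected a b
  obtain ⟨d, -, hd, hd'⟩ := w.exists_boundary_dart T ha hb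
  exact ⟨d.fst, trivial, hd, d.snd, trivial, hd', d.adj⟩

theorem exists_isComponentOf [Finite W] (hx : x ∈ S) : ∃ K, x ∈ K ∧ H.IsComponentOf K S := by
  obtain ⟨K, ⟨hxK, hKS, hcl⟩, hmin⟩ := (Set.toFinite
    {K : Set W | x ∈ K ∧ K ⊆ S ∧ ∀ k ∈ K, ∀ y ∈ S, H.Adj k y → y ∈ K}).exists_minimal
    ⟨S, hx, subset_rfl, fun _ _ _ hy _ => hy⟩
  refine ⟨K, hxK, ⟨⟨x, hxK⟩, fun T a ha haT b hb hbT => ?_⟩, hKS, hcl⟩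
  by_contra! hno
  by_cases hxT : x ∈ T
  · refine hbT (hmin (y := K ∩ T) ⟨⟨hxK, hxT⟩, fun k hk => hKS hk.1, fun k hk y hy hky => ?_⟩
      Set.inter_subset_left hb).2
    have := hcl k hk.1 y hy hky
    exact ⟨this, by_contra fun hyT => hno k hk.1 hk.2 y this hyT hky⟩
  · refine (hmin (y := K \ T) ⟨⟨hxK, hxT⟩, fun k hk => hKS hk.1, fun k hk y hy hky => ?_⟩
      Set.sdiff_subset ha).2 haT
    have := hcl k hk.1 y hy hky
    exact ⟨this, fun hyT => hno y this hyT k hk.1 hk.2 hky.symm⟩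

theorem exists_two_isComponentOf [Finite W] (hS : S.Nonempty) (hn : ¬ H.CutConnected S) :
    ∃ K L, H.IsComponentOf K S ∧ H.IsComponentOf L S ∧ Disjoint K L := by
  obtain ⟨x, hx⟩ := hS
  obtain ⟨K, hxK, hK⟩ := exists_isComponentOf (H := H) hx
  obtain ⟨y, hy, hyK⟩ : ∃ y ∈ S, y ∉ K := by
    by_contra! h
    exact hn (Set.Subset.antisymm hK.2.1 h ▸ hK.1)
  obtain ⟨L, hyL, hL⟩ := exists_isComponentOf (H := H) hy
  refine ⟨K, L, hK, hL, Set.disjoint_left.2 fun z hz hzL => ?_⟩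
  obtain ⟨s, hs, hsK, t, ht, htK, h⟩ := hL.1.2 K z hzL hz y hyL hyK
  exact htK (hK.2.2 s hsK t (hL.2.1 ht) h)

theorem CutConnected.touches_of_isComponentOf (hS : H.CutConnected S) (hx : x ∈ S)
    (hK : H.IsComponentOf K (S \ {x})) : H.Touches K {x} := by
  obtain ⟨hKc, hKS, hcl⟩ := hK
  obtain ⟨k, hk, y, ⟨hy, hyK⟩, h⟩ := hS.touches_diff (fun k hk => (hKS hk).1) hKc.1
    hx fun hxK => (hKS hxK).2 rfl
  refine ⟨k, hk, y, ?_, h⟩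
  by_contra hyx
  exact hyK (hcl k hk y ⟨hy, hyx⟩ h)

theorem CutConnected.diff_isComponentOf (hS : H.CutConnected S) (hx : x ∈ S)
    (hK : H.IsComponentOf K (S \ {x})) : H.CutConnected (S \ K) := by
  obtain ⟨-, hKS, hcl⟩ := hK
  have hxK : x ∉ K := fun h => (hKS h).2 rfl
  refine ⟨⟨x, hx, hxK⟩, fun T c hc hcT d hd hdT => ?_⟩
  by_cases hxT : x ∈ T
  · obtain ⟨s, hs, hsT, t, ht, htT, h⟩ := hS.2 (T ∪ K) c hc.1 (Or.inl hcT) d hd.1 (by grind)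
    have := hcl s
    grind
  · obtain ⟨s, hs, hsT, t, ht, htT, h⟩ := hS.2 (T \ K) c hc.1 ⟨hcT, hc.2⟩ d hd.1 (by grind)
    have := fun h' => hcl t h' s
    have := h.symm
    grind

theorem CutConnected.exists_split [Finite W] (hS : H.CutConnected S) (hp : p ∈ S) (hq : q ∈ S)
    (hpq : p ≠ q) : ∃ P Q, H.CutConnected P ∧ H.CutConnected Q ∧ p ∈ P ∧ q ∈ Q ∧
      P ⊆ S ∧ Q ⊆ S ∧ Disjoint P Q ∧ H.Touches P Q := by
  obtain ⟨Q, hqQ, hQ⟩ := exists_isComponentOf (H := H) (S := S \ {p}) ⟨hq, hpq.symm⟩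
  have hpQ : p ∉ Q := fun h => (hQ.2.1 h).2 rfl
  refine ⟨S \ Q, Q, hS.diff_isComponentOf hp hQ, hQ.1, ⟨hp, hpQ⟩, hqQ, Set.sdiff_subset,
    fun y hy => (hQ.2.1 hy).1, Set.disjoint_sdiff_left, ?_⟩
  exact ((hS.touches_of_isComponentOf hp hQ).mono subset_rfl (by grind)).symm

/-- Two touching connected sets, both attached to `a` and `b`, form a `K₄` model together with a
splitting of a disjoint connected set containing `a` and `b`. -/
theorem hasK4Model_of_touches [Finite W] (hB : H.CutConnected B) (ha : a ∈ B) (hb : b ∈ B)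
    (hab : a ≠ b) (hK : H.CutConnected K) (hL : H.CutConnected L) (hKL : Disjoint K L)
    (hKB : Disjoint K B) (hLB : Disjoint L B) (h : H.Touches K L)
    (hKa : H.Touches K {a}) (hKb : H.Touches K {b})
    (hLa : H.Touches L {a}) (hLb : H.Touches L {b}) : H.HasK4Model := by
  obtain ⟨P, Q, hP, hQ, haP, hbQ, hPB, hQB, hPQ, hT⟩ := hB.exists_split ha hb hab
  rw [← Set.singleton_subset_iff] at haP hbQ
  exact ⟨K, L, P, Q, ⟨hK, hL, hP, hQ⟩,
    ⟨hKL, hKB.mono_right hPB, hKB.mono_right hQB, hLB.mono_right hPB, hLB.mono_right hQB, hPQ⟩,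
    h, hKa.mono subset_rfl haP, hKb.mono subset_rfl hbQ, hLa.mono subset_rfl haP,
    hLb.mono subset_rfl hbQ, hT⟩

theorem hasK4Model_of_two_connected [Finite W] (hA : H.CutConnected A) (hB : H.CutConnected B)
    (hAB : Disjoint A B) (ha : a ∈ B) (hb : b ∈ B) (hab : a ≠ b)
    (hdel : ∀ x ∈ A, H.CutConnected (A \ {x}) ∧ H.Touches (A \ {x}) {a} ∧
      H.Touches (A \ {x}) {b}) : H.HasK4Model := by
  by_contra hno
  have hsplit : ∀ K ⊆ A, H.CutConnected K → H.CutConnected (A \ K) → H.Touches K {a} →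
      H.Touches K {b} → H.Touches (A \ K) {a} → H.Touches (A \ K) {b} → False := by
    intro K hKA hK hK' h1 h2 h3 h4
    obtain ⟨y, hy, hyK⟩ := hK'.1
    exact hno (hasK4Model_of_touches hB ha hb hab hK hK' Set.disjoint_sdiff_right
      (hAB.mono_left hKA) (hAB.mono_left Set.sdiff_subset)
      (hA.touches_diff hKA hK.1 hy hyK) h1 h2 h3 h4)
  obtain ⟨A₁, ⟨hA₁A, hA₁, hA₂, h1a, h2a, h1b⟩, hmax⟩ := (Set.toFinite
    {K : Set W | K ⊆ A ∧ H.CutConnected K ∧ H.CutConnected (A \ K) ∧ H.Touches K {a} ∧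
      H.Touches (A \ K) {a} ∧ ¬ H.Touches K {b}}).exists_maximal (by
    obtain ⟨y, hy⟩ := hA.1
    obtain ⟨-, ⟨x, hx, t, ht, hxt⟩, -⟩ := hdel y hy
    have hxA : {x} ⊆ A := Set.singleton_subset_iff.2 hx.1
    have hxa : H.Touches {x} {a} := ⟨x, rfl, t, ht, hxt⟩
    obtain ⟨h1, h2, h3⟩ := hdel x hx.1
    exact ⟨{x}, hxA, cutConnected_singleton x, h1, hxa, h2, fun hxb =>
      hsplit {x} hxA (cutConnected_singleton x) h1 hxa hxb h2 h3⟩)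
  have hb₂ : ∀ z, H.Touches ((A \ A₁) \ {z}) {b} := by
    intro z
    by_cases hz : z ∈ A
    · obtain ⟨s, hs, t, ht, h⟩ := (hdel z hz).2.2
      exact ⟨s, ⟨⟨hs.1, fun hs₁ => h1b ⟨s, hs₁, t, ht, h⟩⟩, hs.2⟩, t, ht, h⟩
    · obtain ⟨y, hy⟩ := hA.1
      obtain ⟨s, hs, t, ht, h⟩ := (hdel y hy).2.2
      exact ⟨s, ⟨⟨hs.1, fun hs₁ => h1b ⟨s, hs₁, t, ht, h⟩⟩, fun e => hz (e ▸ hs.1)⟩, t, ht, h⟩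
  -- A component of `(A \ A₁) \ {z}` touches `A₁`.
  have hcomp₁ : ∀ z ∈ A \ A₁, ∀ K, H.IsComponentOf K ((A \ A₁) \ {z}) → H.Touches A₁ K := by
    intro z hz K hK
    obtain ⟨y, hy⟩ := hA₁.1
    obtain ⟨k, hk, t, ht, h⟩ := (hdel z hz.1).1.touches_diff (T := K) (x := y)
      (fun k hk => ⟨(hK.2.1 hk).1.1, (hK.2.1 hk).2⟩) hK.1.1
      ⟨hA₁A hy, fun e => hz.2 (e ▸ hy)⟩ (fun hyK => (hK.2.1 hyK).1.2 hy)
    refine ⟨t, by_contra fun ht₁ => ht.2 (hK.2.2 k hk t ?_ h), k, hk, h.symm⟩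
    exact ⟨⟨ht.1.1, ht₁⟩, ht.1.2⟩
  -- Otherwise it could be moved to `A₁`.
  have hcompB : ∀ z ∈ A \ A₁, ∀ K, H.IsComponentOf K ((A \ A₁) \ {z}) → H.Touches K B := by
    intro z hz K hK
    by_contra hKB
    have hKa : ¬ H.Touches K {a} := fun h => hKB (h.mono subset_rfl (by grind))
    have hKb : ¬ H.Touches K {b} := fun h => hKB (h.mono subset_rfl (by grind))
    obtain ⟨k, hk⟩ := hK.1.1
    refine (hK.2.1 hk).1.2 (hmax ⟨?_, hA₁.union hK.1 (hcomp₁ z hz K hK), ?_, ?_, ?_, ?_⟩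
      (Set.subset_union_left (t := K)) (Or.inr hk))
    · exact Set.union_subset hA₁A fun y hy => (hK.2.1 hy).1.1
    · rw [← Set.sdiff_sdiff]
      exact hA₂.diff_isComponentOf hz hK
    · exact h1a.mono Set.subset_union_left subset_rfl
    · obtain ⟨s, hs, t, ht, h⟩ := h2a
      exact ⟨s, ⟨hs.1, fun h' => h'.elim hs.2 fun hsK => hKa ⟨s, hsK, t, ht, h⟩⟩, t, ht, h⟩
    · rintro ⟨s, hs | hs, t, ht, h⟩
      · exact h1b ⟨s, hs, t, ht, h⟩
      · exact hKb ⟨s, hs, t, ht, h⟩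
  have hconn : ∀ z ∈ A \ A₁, H.Touches A₁ {z} → H.CutConnected ((A \ A₁) \ {z}) := by
    intro z hz hz₁
    by_contra hn
    obtain ⟨y, hy, -⟩ := hb₂ z
    obtain ⟨K, L, hK, hL, hKL⟩ := exists_two_isComponentOf ⟨y, hy⟩ hn
    have hd : ∀ K, H.IsComponentOf K ((A \ A₁) \ {z}) →
        Disjoint A₁ K ∧ Disjoint {z} K ∧ Disjoint K B := by
      refine fun K hK => ⟨?_, ?_, ?_⟩
      · exact Set.disjoint_left.2 fun y hy hyK => (hK.2.1 hyK).1.2 hy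
      · exact Set.disjoint_left.2 fun y hy hyK => (hK.2.1 hyK).2 hy
      · exact hAB.mono_left fun y hy => (hK.2.1 hy).1.1
    refine hno ⟨A₁, {z}, K, L ∪ B, ⟨hA₁, cutConnected_singleton z, hK.1,
      hL.1.union hB (hcompB z hz L hL)⟩, ⟨?_, (hd K hK).1, ?_, (hd K hK).2.1, ?_, ?_⟩,
      hz₁, hcomp₁ z hz K hK, ?_, ?_, ?_, ?_⟩
    · exact Set.disjoint_singleton_right.2 hz.2
    · exact Set.disjoint_union_right.2 ⟨(hd L hL).1, hAB.mono_left hA₁A⟩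
    · exact Set.disjoint_union_right.2 ⟨(hd L hL).2.1,
        hAB.mono_left (Set.singleton_subset_iff.2 hz.1)⟩
    · exact Set.disjoint_union_right.2 ⟨hKL, (hd K hK).2.2⟩
    · exact (hcomp₁ z hz L hL).mono subset_rfl Set.subset_union_left
    · exact (hA₂.touches_of_isComponentOf hz hK).symm
    · exact (hA₂.touches_of_isComponentOf hz hL).symm.mono subset_rfl Set.subset_union_left
    · exact (hcompB z hz K hK).mono subset_rfl Set.subset_union_right
  have huniq : ∀ z ∈ A \ A₁, H.Touches A₁ {z} → ¬ H.Touches ((A \ A₁) \ {z}) {a} := by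
    intro z hz hz₁ hza
    have hsub : A₁ ∪ {z} ⊆ A := Set.union_subset hA₁A (Set.singleton_subset_iff.2 hz.1)
    have hc := hA₁.union (cutConnected_singleton z) hz₁
    have hc' := hconn z hz hz₁
    have h1a' : H.Touches (A₁ ∪ {z}) {a} := h1a.mono Set.subset_union_left subset_rfl
    have hb' := hb₂ z
    rw [Set.sdiff_sdiff] at hza hc' hb'
    by_cases hzb : H.Touches (A₁ ∪ {z}) {b}
    · exact hsplit _ hsub hc hc' h1a' hzb hza hb'
    · exact hz.2 (hmax ⟨hsub, hc, hc', h1a', hza, hzb⟩ Set.subset_union_left (Or.inr rfl))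
  obtain ⟨y, hy⟩ := hA₂.1
  obtain ⟨s, hs, z, hz, hsz⟩ := hA.touches_diff hA₁A hA₁.1 hy.1 hy.2
  obtain ⟨y', hy', -⟩ := hb₂ z
  obtain ⟨s', hs', z', hz', hsz'⟩ := (hdel z hz.1).1.touches_diff (T := A₁) (x := y')
    (fun y hy => ⟨hA₁A hy, fun e => hz.2 (e ▸ hy)⟩) hA₁.1 ⟨hy'.1.1, hy'.2⟩ hy'.1.2
  have h1 := huniq z hz ⟨s, hs, z, rfl, hsz⟩
  have h2 := huniq z' ⟨hz'.1.1, hz'.2⟩ ⟨s', hs', z', rfl, hsz'⟩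
  obtain ⟨c, hc, t, ht, hct⟩ := h2a
  by_cases hcz : c = z
  · exact h2 ⟨c, ⟨hc, fun e => hz'.1.2 (e ▸ hcz)⟩, t, ht, hct⟩
  · exact h1 ⟨c, ⟨hc, hcz⟩, t, ht, hct⟩

theorem CutConnected.compl_of_neighbors (hU : H.CutConnected Set.univ)
    (h2 : ∀ x, H.CutConnected {x}ᶜ) (hp : p ∉ K) (hq : q ∉ K)
    (hN : ∀ k ∈ K, ∀ y ∉ K, H.Adj k y → y = p ∨ y = q)
    (hpq : H.Adj p q ∨ ∃ w ∉ K, w ≠ p ∧ w ≠ q) : H.CutConnected Kᶜ := by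
  have hN' : ∀ k ∈ K, ∀ y ∉ K, H.Adj y k → y = p ∨ y = q := fun k hk y hy h =>
    hN k hk y hy h.symm
  refine ⟨⟨p, hp⟩, fun T c hc hcT d hd hdT => ?_⟩
  by_cases hpT : p ∈ T <;> by_cases hqT : q ∈ T
  · obtain ⟨s, -, hs, t, -, ht, h⟩ := hU.2 (K ∪ T) c trivial (by grind) d trivial (by grind)
    grind
  · rcases hpq with hpq | ⟨w, hw, hwp, hwq⟩
    · exact ⟨p, hp, hpT, q, hq, hqT, hpq⟩
    by_cases hwT : w ∈ T
    · obtain ⟨s, hs, hsT, t, ht, htT, h⟩ :=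
        (h2 p).2 (T \ K) w hwp ⟨hwT, hw⟩ q (by grind) (by grind)
      grind
    · obtain ⟨s, hs, hsT, t, ht, htT, h⟩ :=
        (h2 q).2 (T ∪ K) p (by grind) (by grind) w hwq (by grind)
      grind
  · rcases hpq with hpq | ⟨w, hw, hwp, hwq⟩
    · exact ⟨q, hq, hqT, p, hp, hpT, hpq.symm⟩
    by_cases hwT : w ∈ T
    · obtain ⟨s, hs, hsT, t, ht, htT, h⟩ :=
        (h2 q).2 (T \ K) w hwq ⟨hwT, hw⟩ p (by grind) (by grind)
      grind
    · obtain ⟨s, hs, hsT, t, ht, htT, h⟩ :=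
        (h2 p).2 (T ∪ K) q (by grind) (by grind) w hwp (by grind)
      grind
  · obtain ⟨s, -, hs, t, -, ht, h⟩ := hU.2 (T \ K) c trivial (by grind) d trivial (by grind)
    grind

/-- `A` is a connected set avoiding `r`, with connected complement, whose only outside neighbours
are `a` and `b`. -/
def IsLobe (H : SimpleGraph W) (r : W) (A : Set W) (a b : W) : Prop :=
  H.CutConnected A ∧ H.CutConnected Aᶜ ∧ r ∉ A ∧ a ∉ A ∧ b ∉ A ∧ a ≠ b ∧
    ∀ k ∈ A, ∀ y ∉ A, H.Adj k y → y = a ∨ y = b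

theorem exists_isLobe [Finite W] (hU : H.CutConnected Set.univ)
    (h2 : ∀ x, H.CutConnected {x}ᶜ) (h3 : ∀ p q : W, ∃ w, w ≠ p ∧ w ≠ q) (r : W) :
    ∃ A a b, H.IsLobe r A a b := by
  obtain ⟨w, hw, -⟩ := h3 r r
  obtain ⟨r', -, rfl, s, -, hs, hrs⟩ := hU.2 {r} r trivial rfl w trivial hw
  obtain ⟨x, hxr, hxs⟩ := h3 r' s
  obtain ⟨K, -, hK, hKS, hcl⟩ := exists_isComponentOf (H := H) (S := {r', s}ᶜ) (x := x)
    (by grind)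
  have hN : ∀ k ∈ K, ∀ y ∉ K, H.Adj k y → y = r' ∨ y = s := by grind
  have hr : r' ∉ K := by grind
  have hs' : s ∉ K := by grind
  exact ⟨K, r', s, hK, CutConnected.compl_of_neighbors hU h2 hr hs' hN (Or.inl hrs), hr, hr, hs',
    hrs.ne, hN⟩

theorem exists_neighbors_subset_pair [Finite W] (hU : H.CutConnected Set.univ)
    (h2 : ∀ x, H.CutConnected {x}ᶜ) (h3 : ∀ p q : W, ∃ w, w ≠ p ∧ w ≠ q)
    (hK4 : ¬ H.HasK4Model) (r : W) :
    ∃ v, v ≠ r ∧ ∃ a b, ∀ y, H.Adj v y → y = a ∨ y = b := by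
  obtain ⟨A, ⟨a, b, hA, hAc, hr, ha, hb, hab, hN⟩, hmin⟩ := (Set.toFinite
    {A : Set W | ∃ a b, H.IsLobe r A a b}).exists_minimal (exists_isLobe hU h2 h3 r)
  obtain ⟨v, hv⟩ := hA.1
  refine ⟨v, fun e => hr (e ▸ hv), a, b, ?_⟩
  by_contra! hne
  obtain ⟨w, hvw, hwa, hwb⟩ := hne
  have hwA : w ∈ A := by
    by_contra hwA
    rcases hN v hv w hwA hvw with h | h
    exacts [hwa h, hwb h]
  have hcomp : ∀ x ∈ A, ∀ c d, ({c, d} : Set W) = {a, b} →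
      ∀ K, H.IsComponentOf K (A \ {x}) → H.Touches K {d} := by
    intro x hx c d hcd K hK
    by_contra hKd
    have hc : c = a ∧ d = b ∨ c = b ∧ d = a := by
      have h1 : c ∈ ({a, b} : Set W) := hcd ▸ Or.inl rfl
      have h2 : d ∈ ({a, b} : Set W) := hcd ▸ Or.inr rfl
      have h3 : a ∈ ({c, d} : Set W) := hcd ▸ Or.inl rfl
      have h4 : b ∈ ({c, d} : Set W) := hcd ▸ Or.inr rfl
      grind
    have hKA : ∀ k ∈ K, k ∈ A ∧ k ≠ x := fun k hk => hK.2.1 hk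
    have hcl := hK.2.2
    have hxK : x ∉ K := fun h => (hKA x h).2 rfl
    have hNK : ∀ k ∈ K, ∀ y ∉ K, H.Adj k y → y = x ∨ y = c := by
      intro k hk y hy hky
      have h1 : y ≠ d := fun e => hKd ⟨k, hk, y, e, hky⟩
      have h2 := hN k (hKA k hk).1 y
      have h3 := hcl k hk y
      grind
    refine hxK (hmin ⟨x, c, hK.1, ?_, ?_, hxK, ?_, ?_, hNK⟩ (fun k hk => (hKA k hk).1) hx)
    · exact CutConnected.compl_of_neighbors hU h2 hxK (by grind) hNK (Or.inr ⟨d, by grind⟩)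
    · grind
    · grind
    · grind
  have hcompa := fun x hx => hcomp x hx b a (Set.pair_comm b a)
  have hcompb := fun x hx => hcomp x hx a b rfl
  refine hK4 (hasK4Model_of_two_connected hA hAc disjoint_compl_right ha hb hab
    fun x hx => ?_)
  obtain ⟨y, hy⟩ : (A \ {x}).Nonempty := by
    by_cases hxv : x = v
    · exact ⟨w, hwA, fun e => hvw.ne (hxv ▸ e.symm)⟩
    · exact ⟨v, hv, fun e => hxv e.symm⟩
  obtain ⟨K, hyK, hK⟩ := exists_isComponentOf (H := H) hy
  refine ⟨?_, (hcompa x hx K hK).mono hK.2.1 subset_rfl,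
    (hcompb x hx K hK).mono hK.2.1 subset_rfl⟩
  by_contra hn
  obtain ⟨K, L, hK, hL, hKL⟩ := exists_two_isComponentOf ⟨y, hy⟩ hn
  have hLx := hA.touches_of_isComponentOf hx hL
  have hKA : K ⊆ A := fun k hk => (hK.2.1 hk).1
  have hLA : L ∪ {x} ⊆ A :=
    Set.union_subset (fun k hk => (hL.2.1 hk).1) (Set.singleton_subset_iff.2 hx)
  refine hK4 (hasK4Model_of_touches hAc ha hb hab hK.1
    (hL.1.union (cutConnected_singleton x) hLx) ?_ (disjoint_compl_right.mono_left hKA)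
    (disjoint_compl_right.mono_left hLA) ?_ (hcompa x hx K hK) (hcompb x hx K hK) ?_ ?_)
  · exact Set.disjoint_union_right.2
      ⟨hKL, Set.disjoint_singleton_right.2 fun h => (hK.2.1 h).2 rfl⟩
  · exact (hA.touches_of_isComponentOf hx hK).mono subset_rfl Set.subset_union_right
  · exact (hcompa x hx L hL).mono Set.subset_union_left subset_rfl
  · exact (hcompb x hx L hL).mono Set.subset_union_left subset_rfl

theorem CutConnected.image {V : Type*} {G : SimpleGraph V} (f : H →g G)
    (hS : H.CutConnected S) : G.CutConnected (f '' S) := by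
  refine ⟨hS.1.image f, ?_⟩
  rintro T - ⟨c, hc, rfl⟩ hcT - ⟨d, hd, rfl⟩ hdT
  obtain ⟨s, hs, hsT, t, ht, htT, h⟩ := hS.2 (f ⁻¹' T) c hc hcT d hd hdT
  exact ⟨f s, ⟨s, hs, rfl⟩, hsT, f t, ⟨t, ht, rfl⟩, htT, f.map_adj h⟩

theorem IsKConnected.cutConnected_compl [Fintype W] {k : ℕ} (h : H.IsKConnected k)
    (hS : S.ncard < k) : H.CutConnected Sᶜ := by
  have := (h.2 S hS).cutConnected_univ.image (Subgraph.hom _)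
  convert this using 1
  ext y
  simp

theorem CutConnected.preimage_val {u : W} (hS : H.CutConnected S) (hu : u ∉ S) :
    (H.induce {u}ᶜ).CutConnected (Subtype.val ⁻¹' S) := by
  obtain ⟨⟨y, hy⟩, hcut⟩ := hS
  have hne : ∀ s ∈ S, s ≠ u := fun s hs e => hu (e ▸ hs)
  refine ⟨⟨⟨y, hne y hy⟩, hy⟩, fun T c hc hcT d hd hdT => ?_⟩
  obtain ⟨s, hs, ⟨s', hsT, rfl⟩, t, ht, htT, h⟩ := hcut (Subtype.val '' T) c hc ⟨c, hcT, rfl⟩ d hd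
    (by rintro ⟨d', hd', e⟩; exact hdT (Subtype.ext e ▸ hd'))
  exact ⟨s', hs, hsT, ⟨t, hne t ht⟩, ht, fun h' => htT ⟨_, h', rfl⟩, h⟩

/-- Adding a dominating vertex turns a `K₄` model into a `K₅` minor. -/
theorem HasK4Model.hasMinor {u : W} (hu : ∀ v, v ≠ u → H.Adj u v)
    (h : (H.induce {u}ᶜ).HasK4Model) : H.HasMinor (completeGraph (Fin 5)) := by
  obtain ⟨A, B, C, D, ⟨hA, hB, hC, hD⟩, ⟨h1, h2, h3, h4, h5, h6⟩, t1, t2, t3, t4, t5, t6⟩ := h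
  have hdisj : ∀ {S T : Set ({u}ᶜ : Set W)}, Disjoint S T →
      Disjoint (Subtype.val '' S) (Subtype.val '' T) := fun h =>
    (Set.disjoint_image_iff Subtype.val_injective).2 h
  have htouch : ∀ {S T : Set ({u}ᶜ : Set W)}, (H.induce {u}ᶜ).Touches S T →
      H.Touches (Subtype.val '' S) (Subtype.val '' T) := by
    rintro S T ⟨s, hs, t, ht, h⟩
    exact ⟨s, ⟨s, hs, rfl⟩, t, ⟨t, ht, rfl⟩, h⟩
  have hconn : ∀ {S : Set ({u}ᶜ : Set W)}, (H.induce {u}ᶜ).CutConnected S →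
      H.CutConnected (Subtype.val '' S) := fun h => h.image (Embedding.induce _).toHom
  have hdisju : ∀ S : Set ({u}ᶜ : Set W), Disjoint {u} (Subtype.val '' S) := by
    intro S
    rw [Set.disjoint_singleton_left]
    rintro ⟨s, -, e⟩
    exact s.2 e
  have htouchu : ∀ {S : Set ({u}ᶜ : Set W)}, (H.induce {u}ᶜ).CutConnected S →
      H.Touches {u} (Subtype.val '' S) := by
    rintro S ⟨⟨s, hs⟩, -⟩
    exact ⟨u, rfl, s, ⟨s, hs, rfl⟩, hu s s.2⟩
  let f : Fin 5 → Set W := ![{u}, Subtype.val '' A, Subtype.val '' B, Subtype.val '' C,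
    Subtype.val '' D]
  have hlt : ∀ i j : Fin 5, i < j → Disjoint (f i) (f j) ∧ H.Touches (f i) (f j) := by
    intro i j hij
    fin_cases i <;> fin_cases j <;> first
      | exact absurd hij (by decide)
      | exact ⟨hdisju _, htouchu (by assumption)⟩
      | exact ⟨hdisj (by assumption), htouch (by assumption)⟩
  refine ⟨f, fun i => CutConnected.induce_connected ?_, fun i j hij => ?_, fun i j hij => ?_⟩
  · fin_cases i
    exacts [cutConnected_singleton u, hconn hA, hconn hB, hconn hC, hconn hD]
  · rcases lt_or_gt_of_ne hij with h | h
    exacts [(hlt i j h).1, (hlt j i h).1.symm]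
  · rcases lt_or_gt_of_ne hij.ne with h | h
    exacts [(hlt i j h).2, (hlt j i h).2.symm]

theorem IsKConnected.le_degree [Fintype W] [DecidableRel H.Adj] {k : ℕ} (h : H.IsKConnected k)
    (v : W) : k ≤ H.degree v := by
  by_contra! hlt
  have hcard : (H.neighborSet v).ncard < k := by
    rwa [← Nat.card_coe_set_eq, Nat.card_eq_fintype_card, card_neighborSet_eq_degree]
  have hc := h.cutConnected_compl hcard
  obtain ⟨w, hw⟩ : ∃ w, w ∉ insert v (H.neighborSet v) := by
    by_contra! hall
    have h1 := Set.ncard_insert_le v (H.neighborSet v)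
    rw [Set.eq_univ_of_forall hall, Set.ncard_univ, Nat.card_eq_fintype_card] at h1
    have := h.1
    omega
  obtain ⟨s, -, rfl, t, ht, -, hst⟩ := hc.2 {v} v (by simp) rfl w (by grind) (by grind)
  exact ht hst

theorem IsPolyhedron.exists_degree_eq_three [Fintype W] [DecidableEq W] [DecidableRel H.Adj]
    (hH : H.IsPolyhedron) {u : W} (hu : ∀ v, v ≠ u → H.Adj u v) (hr : r ≠ u) :
    ∃ v, v ≠ u ∧ v ≠ r ∧ H.degree v = 3 := by
  obtain ⟨hP, h3⟩ := hH
  have hU : (H.induce {u}ᶜ).CutConnected Set.univ := by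
    convert (h3.cutConnected_compl (S := {u}) (by simp)).preimage_val (u := u) (by simp) using 1
    ext y
    simp
  have h2 : ∀ x, (H.induce {u}ᶜ).CutConnected {x}ᶜ := by
    intro x
    convert (h3.cutConnected_compl (S := {u, x.1})
      ((Set.ncard_insert_le _ _).trans_lt (by simp))).preimage_val (u := u) (by simp) using 1
    ext y
    have hy : y.1 ≠ u := y.2
    simp [Subtype.ext_iff, hy]
  have hthree : ∀ p q : ({u}ᶜ : Set W), ∃ w, w ≠ p ∧ w ≠ q := by
    intro p q
    obtain ⟨w, hw⟩ : ∃ w, w ∉ ({u, p.1, q.1} : Finset W) := by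
      by_contra! hall
      have h1 : ({u, p.1, q.1} : Finset W).card ≤ 3 := Finset.card_le_three
      rw [Finset.eq_univ_iff_forall.2 hall, Finset.card_univ] at h1
      have := h3.1
      omega
    simp only [Finset.mem_insert, Finset.mem_singleton, not_or] at hw
    exact ⟨⟨w, hw.1⟩, fun e => hw.2.1 (congrArg Subtype.val e),
      fun e => hw.2.2 (congrArg Subtype.val e)⟩
  obtain ⟨v, hvr, a, b, hN⟩ := exists_neighbors_subset_pair hU h2 hthree
    (fun h => hP.1 (h.hasMinor hu)) ⟨r, hr⟩
  refine ⟨v, v.2, fun e => hvr (Subtype.ext e), le_antisymm ?_ (h3.le_degree v)⟩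
  rw [← card_neighborFinset_eq_degree]
  refine (Finset.card_le_card (t := {u, a.1, b.1}) fun y hy => ?_).trans Finset.card_le_three
  rw [mem_neighborFinset] at hy
  by_cases hyu : y = u
  · simp [hyu]
  · rcases hN ⟨y, hyu⟩ hy with h | h <;> simp [← h]

end SimpleGraph

/-- A polyhedron with a vertex of eccentricity `1` (a vertex
adjacent to all other vertices) has at least two vertices of degree `3`. -/
theorem stmt9 {V : Type*} [Fintype V] [DecidableEq V] (G : SimpleGraph V)
    [DecidableRel G.Adj] (hG : G.IsPolyhedron)
    (u : V) (hu : ∀ v : V, v ≠ u → G.Adj u v) :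
    ∃ v w : V, v ≠ w ∧ G.degree v = 3 ∧ G.degree w = 3 := by
  obtain ⟨r, hr⟩ : ∃ r, r ≠ u :=
    have : Nontrivial V := Fintype.one_lt_card_iff_nontrivial.1 (by have := hG.2.1; omega)
    exists_ne u
  obtain ⟨v, hv, -, hv3⟩ := hG.exists_degree_eq_three hu hr
  obtain ⟨w, -, hwv, hw3⟩ := hG.exists_degree_eq_three hu hv
  exact ⟨v, w, hwv.symm, hv3, hw3⟩
end

section
/- Let G be a polyhedron and u a vertex of G of eccentricity 1 (i.e., adjacent to all other vertices). Then for every vertex v ≠ u one has |N(v,u)| = deg_G(v) − 1 ≥ 2, and for every pair of distinct vertices v, w both different from u one has 1 ≤ |N(v,w)| ≤ 3; moreover |N(v,w)| = 3 if and only if v and w are non-consecutive vertices along some 4-cycle of the graph G − u obtained by deleting u. -/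
open SimpleGraph

/-- A graph that maps injectively into `G` is a minor of `G`. -/
theorem SimpleGraph.HasMinor.of_injective_hom {V W : Type*} {G : SimpleGraph V}
    {H : SimpleGraph W} (φ : H →g G) (hφ : Function.Injective φ) : G.HasMinor H := by
  refine ⟨fun w => {φ w}, fun w => ?_, fun a b hab => ?_, fun a b hab => ?_⟩
  · rw [induce_singleton_eq_top]
    exact connected_top
  · simpa using fun h => hab (hφ h)
  · exact ⟨_, rfl, _, rfl, φ.map_adj hab⟩

/-- Six vertices spanning a complete bipartite graph with parts of size three give a `K₃,₃`
minor. -/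
theorem SimpleGraph.hasMinor_completeBipartiteGraph_three {V : Type*} {G : SimpleGraph V}
    (a b : Fin 3 → V) (ha : Function.Injective a) (hb : Function.Injective b)
    (hab : ∀ i j, G.Adj (a i) (b j)) :
    G.HasMinor (completeBipartiteGraph (Fin 3) (Fin 3)) := by
  refine HasMinor.of_injective_hom ⟨Sum.elim a b, ?_⟩ (ha.sumElim hb fun i j => (hab i j).ne)
  rintro (i | i) (j | j) h
  · simp at h
  · exact hab i j
  · exact (hab j i).symm
  · simp at h

/-- Every vertex of a `k`-connected graph has degree at least `k`. -/
theorem SimpleGraph.IsKConnected.le_degree_s10 {V : Type*} [Fintype V] {k : ℕ}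
    {G : SimpleGraph V} [DecidableRel G.Adj] (hG : G.IsKConnected k) (v : V) :
    k ≤ G.degree v := by
  classical
  by_contra! hlt
  have hcard : (G.neighborSet v).ncard = G.degree v := by
    rw [Set.ncard_eq_toFinset_card', ← neighborFinset_def, card_neighborFinset_eq_degree]
  have hconn := hG.2 (G.neighborSet v) (hcard ▸ hlt)
  obtain ⟨w, hw⟩ : ∃ w, w ∉ insert v (G.neighborFinset v) := by
    by_contra! hall
    have h₁ : insert v (G.neighborFinset v) = Finset.univ := Finset.eq_univ_iff_forall.2 hall
    have h₂ := Finset.card_insert_le v (G.neighborFinset v)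
    rw [h₁, Finset.card_univ, card_neighborFinset_eq_degree] at h₂
    have := hG.1
    omega
  simp only [Finset.mem_insert, mem_neighborFinset, not_or] at hw
  have hv' : v ∈ ((⊤ : G.Subgraph).deleteVerts (G.neighborSet v)).verts := by simp
  have hw' : w ∈ ((⊤ : G.Subgraph).deleteVerts (G.neighborSet v)).verts := by simpa using hw.2
  have hne : (⟨v, hv'⟩ : ((⊤ : G.Subgraph).deleteVerts (G.neighborSet v)).verts) ≠ ⟨w, hw'⟩ :=
    fun h => hw.1 (congrArg Subtype.val h).symm
  have : Nontrivial ((⊤ : G.Subgraph).deleteVerts (G.neighborSet v)).verts := ⟨_, _, hne⟩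
  obtain ⟨⟨x, hx⟩, hadj⟩ := hconn.preconnected.exists_adj_of_nontrivial ⟨v, hv'⟩
  simp at hadj

/-- If `u` is adjacent to all other vertices of a graph without `K₃,₃` minor, then two further
vertices have at most three common neighbours. -/
theorem SimpleGraph.IsPlanar.ncard_commonNeighbors_le_three {V : Type*} [Finite V]
    {G : SimpleGraph V} (hG : G.IsPlanar) {u v w : V} (hu : ∀ x, x ≠ u → G.Adj u x)
    (hv : v ≠ u) (hw : w ≠ u) (hvw : v ≠ w) : (G.commonNeighbors v w).ncard ≤ 3 := by
  by_contra! hlt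
  have hmem : u ∈ G.commonNeighbors v w := ⟨(hu v hv).symm, (hu w hw).symm⟩
  have h₂ : 2 < (G.commonNeighbors v w \ {u}).ncard := by
    rw [Set.ncard_sdiff_singleton_of_mem hmem]
    omega
  obtain ⟨x, y, z, hx, hy, hz, hxy, hxz, hyz⟩ := (Set.two_lt_ncard_iff (Set.toFinite _)).1 h₂
  refine hG.2 (hasMinor_completeBipartiteGraph_three ![u, v, w] ![x, y, z] ?_ ?_ ?_)
  · intro i j h
    fin_cases i <;> fin_cases j <;> simp_all
  · intro i j h
    fin_cases i <;> fin_cases j <;> simp_all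
  · have key : ∀ t ∈ G.commonNeighbors v w \ {u}, ∀ i, G.Adj (![u, v, w] i) t := by
      rintro t ⟨⟨htv, htw⟩, htu⟩ i
      fin_cases i
      exacts [hu t htu, htv, htw]
    intro i j
    fin_cases j
    exacts [key x hx i, key y hy i, key z hz i]

/-- Let `G` be a polyhedron and `u` a vertex of
eccentricity `1` (adjacent to all other vertices). Then every `v ≠ u` has
`|N(v,u)| = deg v - 1 ≥ 2`, and distinct `v, w ≠ u` satisfy
`1 ≤ |N(v,w)| ≤ 3`, with `|N(v,w)| = 3` iff `v, w` are non-consecutive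
vertices along a `4`-cycle of `G - u`. -/
theorem stmt10 {V : Type*} [Fintype V] [DecidableEq V] (G : SimpleGraph V)
    [DecidableRel G.Adj] (hG : G.IsPolyhedron)
    (u : V) (hu : ∀ v : V, v ≠ u → G.Adj u v) :
    (∀ v : V, v ≠ u →
      (G.commonNeighbors v u).ncard = G.degree v - 1 ∧
      2 ≤ (G.commonNeighbors v u).ncard) ∧
    (∀ v w : V, v ≠ u → w ≠ u → v ≠ w →
      1 ≤ (G.commonNeighbors v w).ncard ∧ (G.commonNeighbors v w).ncard ≤ 3 ∧
      ((G.commonNeighbors v w).ncard = 3 ↔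
        ∃ x y : V, x ≠ u ∧ y ≠ u ∧ x ≠ y ∧
          G.Adj v x ∧ G.Adj x w ∧ G.Adj w y ∧ G.Adj y v)) := by
  refine ⟨fun v hv => ?_, fun v w hv hw hvw => ?_⟩
  · have heq : G.commonNeighbors v u = G.neighborSet v \ {u} := by
      ext x
      simp only [mem_commonNeighbors, Set.mem_sdiff, mem_neighborSet, Set.mem_singleton_iff]
      exact ⟨fun h => ⟨h.1, h.2.ne'⟩, fun h => ⟨h.1, hu x h.2⟩⟩
    have hvu : u ∈ G.neighborSet v := (hu v hv).symm
    have hcard : (G.commonNeighbors v u).ncard = G.degree v - 1 := by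
      rw [heq, Set.ncard_sdiff_singleton_of_mem hvu, Set.ncard_eq_toFinset_card',
        ← neighborFinset_def, card_neighborFinset_eq_degree]
    have := hG.2.le_degree_s10 v
    exact ⟨hcard, by omega⟩
  · have hmem : u ∈ G.commonNeighbors v w := ⟨(hu v hv).symm, (hu w hw).symm⟩
    have hle := hG.1.ncard_commonNeighbors_le_three hu hv hw hvw
    have hpos : 0 < (G.commonNeighbors v w).ncard := (Set.ncard_pos).2 ⟨u, hmem⟩
    have hdiff := Set.ncard_sdiff_singleton_of_mem hmem
    refine ⟨hpos, hle, fun h => ?_, ?_⟩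
    · obtain ⟨x, y, hx, hy, hxy⟩ :=
        (Set.one_lt_ncard_iff (Set.toFinite (G.commonNeighbors v w \ {u}))).1 (by omega)
      exact ⟨x, y, hx.2, hy.2, hxy, hx.1.1, hx.1.2.symm, hy.1.2, hy.1.1.symm⟩
    · rintro ⟨x, y, hxu, hyu, hxy, hvx, hxw, hwy, hyv⟩
      have : 1 < (G.commonNeighbors v w \ {u}).ncard :=
        (Set.one_lt_ncard_iff (Set.toFinite _)).2
          ⟨x, y, ⟨⟨hvx, hxw.symm⟩, hxu⟩, ⟨⟨hyv.symm, hwy⟩, hyu⟩, hxy⟩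
      omega
end

section
/- Let G be a polyhedron with 1 ∈ A(G). Then A(G) is one of the following sets: {0,1}; {0,1,2}; {0,1,2} ∪ S₃ for some finite non-empty set S₃ of integers each ≥ 3; {1,2}; {1,2,3}; {1,2,3} ∪ S₄ for some finite non-empty set S₄ of integers each ≥ 4; {1,2,4}; {1,2,4} ∪ S₅ for some finite non-empty set S₅ of integers each ≥ 5; or {1,2,ℓ} for some even integer ℓ ≥ 6. -/
open SimpleGraph

/-- The vertices that can be reached from `y` by steps into `S`. -/
def SimpleGraph.reach {V : Type*} (G : SimpleGraph V) (S : Set V) (y : V) : Set V :=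
  {z | Relation.ReflTransGen (fun a b => G.Adj a b ∧ b ∈ S) y z}

namespace SimpleGraph

variable {V : Type*} {G : SimpleGraph V}

lemma connected_induce_of_reach {C : Set V} {y : V} (hy : y ∈ C) (h : C ⊆ G.reach C y) :
    (G.induce C).Connected := by
  have key : ∀ z, Relation.ReflTransGen (fun a b => G.Adj a b ∧ b ∈ C) y z →
      ∃ hz : z ∈ C, (G.induce C).Reachable ⟨y, hy⟩ ⟨z, hz⟩ := by
    intro z hz
    induction hz with
    | refl => exact ⟨hy, Reachable.refl _⟩
    | tail _ hbc ih =>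
      obtain ⟨hb, hr⟩ := ih
      refine ⟨hbc.2, hr.trans (Adj.reachable ?_)⟩
      exact hbc.1
  have : Nonempty C := ⟨⟨y, hy⟩⟩
  refine ⟨fun a b => ?_⟩
  obtain ⟨_, ha⟩ := key a (h a.2)
  obtain ⟨_, hb⟩ := key b (h b.2)
  exact ha.symm.trans hb

lemma mem_reach_self (S : Set V) (y : V) : y ∈ G.reach S y := Relation.ReflTransGen.refl

lemma mem_reach_of_adj {S : Set V} {y a b : V} (ha : a ∈ G.reach S y) (hab : G.Adj a b)
    (hb : b ∈ S) : b ∈ G.reach S y :=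
  Relation.ReflTransGen.tail ha ⟨hab, hb⟩

lemma eq_or_mem_of_mem_reach {S : Set V} {y z : V} (h : z ∈ G.reach S y) : z = y ∨ z ∈ S := by
  rcases Relation.ReflTransGen.cases_tail h with h | ⟨c, _, hc⟩
  · exact .inl h
  · exact .inr hc.2

lemma reach_subset {S : Set V} {y : V} (hy : y ∈ S) : G.reach S y ⊆ S := by
  intro z hz
  rcases eq_or_mem_of_mem_reach hz with rfl | h
  exacts [hy, h]

lemma reach_trans {S : Set V} {x y z : V} (hxy : y ∈ G.reach S x) (hyz : z ∈ G.reach S y) :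
    z ∈ G.reach S x :=
  Relation.ReflTransGen.trans hxy hyz

lemma reach_symm {S : Set V} {x y : V} (hx : x ∈ S) (h : y ∈ G.reach S x) :
    x ∈ G.reach S y := by
  induction h with
  | refl => exact mem_reach_self _ _
  | tail hb hbc ih =>
    exact reach_trans (mem_reach_of_adj (mem_reach_self _ _) hbc.1.symm (reach_subset hx hb)) ih

lemma connected_induce_reach (S : Set V) (y : V) : (G.induce (G.reach S y)).Connected := by
  refine connected_induce_of_reach (mem_reach_self S y) fun z hz => ?_
  induction hz with
  | refl => exact mem_reach_self _ _
  | tail hb hbc ih => exact mem_reach_of_adj ih hbc.1 (mem_reach_of_adj hb hbc.1 hbc.2)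

lemma connected_induce_singleton (a : V) : (G.induce {a}).Connected :=
  connected_induce_of_reach (Set.mem_singleton a) fun z hz => by
    rw [Set.mem_singleton_iff] at hz
    subst hz
    exact mem_reach_self _ _

lemma connected_induce_triple {a b c : V} (hab : G.Adj a b) (hbc : G.Adj b c) :
    (G.induce {a, b, c}).Connected := by
  have hb : b ∈ G.reach {a, b, c} a := mem_reach_of_adj (mem_reach_self _ _) hab (by simp)
  refine connected_induce_of_reach (y := a) (by simp) ?_
  rintro z (rfl | rfl | rfl)
  exacts [mem_reach_self _ _, hb, mem_reach_of_adj hb hbc (by simp)]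

/-- No edge-rooted `K₃,₃`: five of the six branch sets are single vertices. -/
lemma IsPlanar.false_of_K33 (hG : G.IsPlanar) {p q x y z : V} {C : Set V}
    (hC : (G.induce C).Connected) (hpq : p ≠ q) (hxy : x ≠ y) (hxz : x ≠ z) (hyz : y ≠ z)
    (hp : p ∉ C) (hq : q ∉ C) (hx : x ∉ C) (hy : y ∉ C) (hz : z ∉ C)
    (hpx : G.Adj p x) (hpy : G.Adj p y) (hpz : G.Adj p z)
    (hqx : G.Adj q x) (hqy : G.Adj q y) (hqz : G.Adj q z)
    (hCx : ∃ c ∈ C, G.Adj c x) (hCy : ∃ c ∈ C, G.Adj c y) (hCz : ∃ c ∈ C, G.Adj c z) : False := by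
  apply hG.2
  refine ⟨Sum.elim ![{p}, {q}, C] ![{x}, {y}, {z}], ?_, ?_, ?_⟩
  · rintro (i | i) <;> fin_cases i <;> simp only [Sum.elim_inl, Sum.elim_inr] <;>
      first | exact connected_induce_singleton _ | exact hC
  · rintro (i | i) (j | j) hij <;> fin_cases i <;> fin_cases j <;>
      simp_all [hpx.ne, hpy.ne, hpz.ne, hqx.ne, hqy.ne, hqz.ne, hpx.ne', hpy.ne', hpz.ne',
        hqx.ne', hqy.ne', hqz.ne', hpq.symm, hxy.symm, hxz.symm, hyz.symm]
  · have key : ∀ i j : Fin 3, ∃ v₁ ∈ (![{p}, {q}, C] : Fin 3 → Set V) i,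
        ∃ v₂ ∈ (![{x}, {y}, {z}] : Fin 3 → Set V) j, G.Adj v₁ v₂ := by
      intro i j
      fin_cases i <;> fin_cases j <;> simpa
    rintro (i | i) (j | j) hij
    · simp at hij
    · exact key i j
    · obtain ⟨a, ha, b, hb, hab⟩ := key j i
      exact ⟨b, hb, a, ha, hab.symm⟩
    · simp at hij

lemma IsPlanar.false_of_K5 (hG : G.IsPlanar) {A B C D E : Set V}
    (hA : (G.induce A).Connected) (hB : (G.induce B).Connected) (hC : (G.induce C).Connected)
    (hD : (G.induce D).Connected) (hE : (G.induce E).Connected)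
    (dAB : Disjoint A B) (dAC : Disjoint A C) (dAD : Disjoint A D) (dAE : Disjoint A E)
    (dBC : Disjoint B C) (dBD : Disjoint B D) (dBE : Disjoint B E)
    (dCD : Disjoint C D) (dCE : Disjoint C E) (dDE : Disjoint D E)
    (hAB : ∃ a ∈ A, ∃ b ∈ B, G.Adj a b) (hAC : ∃ a ∈ A, ∃ b ∈ C, G.Adj a b)
    (hAD : ∃ a ∈ A, ∃ b ∈ D, G.Adj a b) (hAE : ∃ a ∈ A, ∃ b ∈ E, G.Adj a b)
    (hBC : ∃ a ∈ B, ∃ b ∈ C, G.Adj a b) (hBD : ∃ a ∈ B, ∃ b ∈ D, G.Adj a b)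
    (hBE : ∃ a ∈ B, ∃ b ∈ E, G.Adj a b) (hCD : ∃ a ∈ C, ∃ b ∈ D, G.Adj a b)
    (hCE : ∃ a ∈ C, ∃ b ∈ E, G.Adj a b) (hDE : ∃ a ∈ D, ∃ b ∈ E, G.Adj a b) : False := by
  apply hG.1
  have lt : ∀ i j : Fin 5, i < j → Disjoint (![A, B, C, D, E] i) (![A, B, C, D, E] j) ∧
      ∃ a ∈ ![A, B, C, D, E] i, ∃ b ∈ ![A, B, C, D, E] j, G.Adj a b := by
    intro i j hij
    fin_cases i <;> fin_cases j <;> first | exact absurd hij (by decide) | constructor <;> assumption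
  refine ⟨![A, B, C, D, E], ?_, ?_, ?_⟩
  · intro i
    fin_cases i <;> assumption
  · intro i j hij
    rcases lt_or_gt_of_ne hij with h | h
    exacts [(lt i j h).1, (lt j i h).1.symm]
  · intro i j hij
    rcases lt_or_gt_of_ne hij.ne with h | h
    · exact (lt i j h).2
    · obtain ⟨a, ha, b, hb, hab⟩ := (lt j i h).2
      exact ⟨b, hb, a, ha, hab.symm⟩

/-- A complete graph on four vertices together with a connected set that meets all four of their
neighbourhoods yields a `K₅` minor. -/
lemma IsPlanar.false_of_K4_of_connected (hG : G.IsPlanar) {a b c d : V} {C : Set V}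
    (hC : (G.induce C).Connected)
    (hab : G.Adj a b) (hac : G.Adj a c) (had : G.Adj a d) (hbc : G.Adj b c) (hbd : G.Adj b d)
    (hcd : G.Adj c d) (ha : a ∉ C) (hb : b ∉ C) (hc : c ∉ C) (hd : d ∉ C)
    (hCa : ∃ t ∈ C, G.Adj a t) (hCb : ∃ t ∈ C, G.Adj b t) (hCc : ∃ t ∈ C, G.Adj c t)
    (hCd : ∃ t ∈ C, G.Adj d t) : False := by
  refine hG.false_of_K5 (connected_induce_singleton a) (connected_induce_singleton b)
    (connected_induce_singleton c) (connected_induce_singleton d) hC ?_ ?_ ?_ ?_ ?_ ?_ ?_ ?_ ?_ ?_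
    ?_ ?_ ?_ ?_ ?_ ?_ ?_ ?_ ?_ ?_ <;>
  simp_all [hab.ne, hac.ne, had.ne, hbc.ne, hbd.ne, hcd.ne]

/-- Removing at most two vertices from a 3-connected graph leaves a connected graph. -/
lemma IsKConnected.mem_of_closed [Fintype V] (hG : G.IsKConnected 3) {u v r t : V} {R : Set V}
    (hr : r ∈ R) (hru : r ≠ u) (hrv : r ≠ v)
    (hR : ∀ a ∈ R, ∀ b, a ≠ u → a ≠ v → G.Adj a b → b ≠ u → b ≠ v → b ∈ R)
    (htu : t ≠ u) (htv : t ≠ v) : t ∈ R := by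
  have hS : ({u, v} : Set V).ncard < 3 := lt_of_le_of_lt (Set.ncard_insert_le u {v}) (by simp)
  have hconn := hG.2 {u, v} hS
  obtain ⟨p⟩ := hconn.preconnected ⟨r, by simp [hru, hrv]⟩ ⟨t, by simp [htu, htv]⟩
  have key : ∀ a b, ((⊤ : G.Subgraph).deleteVerts {u, v}).coe.Walk a b → a.1 ∈ R → b.1 ∈ R := by
    intro a b p
    induction p with
    | nil => exact id
    | @cons a b c h p ih =>
      intro ha
      have h1 := a.2
      have h2 := b.2
      simp at h1 h2 h
      exact ih (hR _ ha _ h1.1 h1.2 h.2.2 h2.1 h2.2)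
  exact key _ _ p hr

end SimpleGraph

namespace SimpleGraph

variable {V : Type*} {G : SimpleGraph V}

/-- Infinite descent on the set `S` of vertices enclosed by the 4-cycle `a b c d`. -/
lemma IsPlanar.false_of_third_commonNeighbor [Finite V] (hG : G.IsPlanar)
    (third : ∀ a b x y, a ≠ b → x ≠ y → G.Adj a x → G.Adj b x → G.Adj a y → G.Adj b y →
      ∃ z, z ≠ x ∧ z ≠ y ∧ G.Adj a z ∧ G.Adj b z)
    (n : ℕ) : ∀ (S : Set V) (a b c d x : V), S.ncard ≤ n → G.Adj a b → G.Adj b c → G.Adj c d →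
      G.Adj d a → a ≠ c → b ≠ d → a ∉ S → b ∉ S → c ∉ S → d ∉ S →
      (∀ s ∈ S, ∀ t, G.Adj s t → t ∈ S ∨ t = a ∨ t = b ∨ t = c ∨ t = d) →
      x ∈ S → G.Adj b x → G.Adj d x → False := by
  induction n with
  | zero =>
    intro S a b c d x hn _ _ _ _ _ _ _ _ _ _ _ hx
    have : S = ∅ := (Set.ncard_eq_zero S.toFinite).1 (Nat.le_zero.1 hn)
    simp [this] at hx
  | succ n ih =>
    intro S a b c d x hn hab hbc hcd hda hac hbd ha hb hc hd hS hx hbx hdx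
    have hne : ∀ {p q}, p ∉ S → q ∈ S → q ≠ p := fun hp hq h => hp (h ▸ hq)
    have hxa := hne ha hx
    have hxb := hne hb hx
    have hxc := hne hc hx
    have hxd := hne hd hx
    have hcard : (S \ {x}).ncard ≤ n := by
      have := Set.ncard_sdiff_singleton_add_one hx S.toFinite
      omega
    have hcomp : ∀ y ∈ S \ {x}, (G.reach (S \ {x}) y).ncard ≤ n := fun y hy =>
      (Set.ncard_le_ncard (reach_subset hy) (Set.toFinite _)).trans hcard
    have hbdry : ∀ y ∈ S \ {x}, ∀ s ∈ G.reach (S \ {x}) y, ∀ t, G.Adj s t →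
        t ∈ G.reach (S \ {x}) y ∨ t = x ∨ t = a ∨ t = b ∨ t = c ∨ t = d := by
      intro y hy s hs t hst
      by_cases htx : t = x
      · exact .inr (.inl htx)
      rcases hS s (reach_subset hy hs).1 t hst with h | h
      · exact .inl (mem_reach_of_adj hs hst ⟨h, htx⟩)
      · exact .inr (.inr h)
    have hout : ∀ y ∈ S \ {x}, ∀ s, s ∉ S ∨ s = x → s ∉ G.reach (S \ {x}) y := by
      intro y hy s hs h
      have := reach_subset hy h
      rcases hs with hs | hs
      exacts [hs this.1, this.2 hs]
    have inner : ∀ e f, (e = a ∧ f = c ∨ e = c ∧ f = a) → ∀ y ∈ S, G.Adj e y → ¬ G.Adj x y := by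
      intro e f hef y hyS hey hxy
      have hy : y ∈ S \ {x} := ⟨hyS, hxy.ne'⟩
      have heS : e ∉ S := by rcases hef with h | h <;> rw [h.1] <;> assumption
      have hfS : f ∉ S := by rcases hef with h | h <;> rw [h.2] <;> assumption
      have hbe : G.Adj b e := by rcases hef with h | h <;> rw [h.1] <;> simp [hab.symm, hbc]
      have hde : G.Adj d e := by rcases hef with h | h <;> rw [h.1] <;> simp [hda, hcd.symm]
      have hbf : G.Adj b f := by rcases hef with h | h <;> rw [h.2] <;> simp [hab.symm, hbc]
      have hdf : G.Adj d f := by rcases hef with h | h <;> rw [h.2] <;> simp [hda, hcd.symm]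
      have hef' : e ≠ f := by rcases hef with h | h <;> rw [h.1, h.2] <;> simp [hac, hac.symm]
      have hyy := mem_reach_self (G := G) (S \ {x}) y
      have hf : ∀ s ∈ G.reach (S \ {x}) y, ¬ G.Adj s f := by
        intro s hs hsf
        exact hG.false_of_K33 (connected_induce_reach (S \ {x}) y) hbd (hne heS hx).symm hef'
          (hne hfS hx) (hout y hy b (.inl hb)) (hout y hy d (.inl hd)) (hout y hy e (.inl heS))
          (hout y hy x (.inr rfl)) (hout y hy f (.inl hfS)) hbe hbx hbf hde hdx hdf
          ⟨y, hyy, hey.symm⟩ ⟨y, hyy, hxy.symm⟩ ⟨s, hs, hsf⟩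
      refine ih (G.reach (S \ {x}) y) b e d x y (hcomp y hy) hbe hde.symm hdx hbx.symm hbd
        (hne heS hx).symm (hout y hy b (.inl hb)) (hout y hy e (.inl heS))
        (hout y hy d (.inl hd)) (hout y hy x (.inr rfl)) ?_ hyy hey hxy
      intro s hs t hst
      have h1 := hbdry y hy s hs t hst
      have h2 : t ≠ f := fun h => hf s hs (h ▸ hst)
      rcases hef with ⟨rfl, rfl⟩ | ⟨rfl, rfl⟩ <;> tauto
    have chord : ∀ e f, (e = a ∧ f = c ∨ e = c ∧ f = a) → G.Adj x f ∧ G.Adj e f := by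
      intro e f hef
      have hex : e ≠ x := by rcases hef with h | h <;> rw [h.1] <;> simp [hxa.symm, hxc.symm]
      have heb : G.Adj e b := by rcases hef with h | h <;> rw [h.1] <;> simp [hab, hbc.symm]
      have hed : G.Adj e d := by rcases hef with h | h <;> rw [h.1] <;> simp [hda.symm, hcd]
      obtain ⟨z, hzb, hzd, hez, hxz⟩ := third e x b d hex hbd heb hbx.symm hed hdx.symm
      have hzS : z ∉ S := fun h => inner e f hef z h hez hxz
      have hzf : z = f := by
        have h1 := hS x hx z hxz
        have h2 := hez.ne'
        rcases hef with ⟨rfl, rfl⟩ | ⟨rfl, rfl⟩ <;> tauto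
      exact hzf ▸ ⟨hxz, hez⟩
    obtain ⟨hxc', hac'⟩ := chord a c (.inl ⟨rfl, rfl⟩)
    obtain ⟨hxa', -⟩ := chord c a (.inr ⟨rfl, rfl⟩)
    have hbd' : ¬ G.Adj b d := by
      intro h
      refine hG.false_of_K4_of_connected (connected_induce_singleton x) hab hac' hda.symm hbc h hcd
        ?_ ?_ ?_ ?_ ?_ ?_ ?_ ?_ <;> simp [*, hxa.symm, hxb.symm, hxc.symm, hxd.symm, hxa'.symm,
          hxc'.symm]
    obtain ⟨y, hya, hyc, hby, hxy⟩ := third b x a c hxb.symm hac hab.symm hxa' hbc hxc'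
    have hyS : y ∈ S := by
      rcases hS x hx y hxy with h | h | h | h | h
      · exact h
      · exact absurd h hya
      · exact absurd h hby.ne'
      · exact absurd h hyc
      · exact absurd (h ▸ hby) hbd'
    have hy : y ∈ S \ {x} := ⟨hyS, hxy.ne'⟩
    have hyy := mem_reach_self (G := G) (S \ {x}) y
    have hfd : ∀ s ∈ G.reach (S \ {x}) y, ¬ G.Adj s d := by
      intro s hs hsd
      exact hG.false_of_K33 (connected_induce_reach (S \ {x}) y) hac hxb.symm hbd
        hxd (hout y hy a (.inl ha)) (hout y hy c (.inl hc)) (hout y hy b (.inl hb))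
        (hout y hy x (.inr rfl)) (hout y hy d (.inl hd)) hab hxa'.symm hda.symm hbc.symm hxc'.symm
        hcd ⟨y, hyy, hby.symm⟩ ⟨y, hyy, hxy.symm⟩ ⟨s, hs, hsd⟩
    have hfac : ∃ e f, (e = a ∧ f = c ∨ e = c ∧ f = a) ∧
        ∀ s ∈ G.reach (S \ {x}) y, ¬ G.Adj s f := by
      by_contra! hcon
      obtain ⟨s, hs, hsc⟩ := hcon a c (.inl ⟨rfl, rfl⟩)
      obtain ⟨t, ht, hta⟩ := hcon c a (.inr ⟨rfl, rfl⟩)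
      exact hG.false_of_K4_of_connected (connected_induce_reach (S \ {x}) y) hab hac' hxa'.symm
        hbc hbx hxc'.symm (hout y hy a (.inl ha)) (hout y hy b (.inl hb)) (hout y hy c (.inl hc))
        (hout y hy x (.inr rfl)) ⟨t, ht, hta.symm⟩ ⟨y, hyy, hby⟩ ⟨s, hs, hsc.symm⟩ ⟨y, hyy, hxy⟩
    obtain ⟨e, f, hef, hf⟩ := hfac
    have heS : e ∉ S := by rcases hef with h | h <;> rw [h.1] <;> assumption
    have hbe : G.Adj b e := by rcases hef with h | h <;> rw [h.1] <;> simp [hab.symm, hbc]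
    have hxe : G.Adj x e := by rcases hef with h | h <;> rw [h.1] <;> simp [hxa', hxc']
    have hN : ∀ s ∈ G.reach (S \ {x}) y, ∀ t, G.Adj s t →
        t ∈ G.reach (S \ {x}) y ∨ t = x ∨ t = e ∨ t = b := by
      intro s hs t hst
      have h1 := hbdry y hy s hs t hst
      have h2 : t ≠ f := fun h => hf s hs (h ▸ hst)
      have h3 : t ≠ d := fun h => hfd s hs (h ▸ hst)
      rcases hef with ⟨rfl, rfl⟩ | ⟨rfl, rfl⟩ <;> tauto
    obtain ⟨z, hzb, hzx, hyz, hez⟩ := third y e b x (hne heS hyS) hxb.symm hby.symm hbe.symm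
      hxy.symm hxe.symm
    have hz : z ∈ G.reach (S \ {x}) y := by
      rcases hN y hyy z hyz with h | h | h | h
      · exact h
      · exact absurd h hzx
      · exact absurd h hez.ne'
      · exact absurd h hzb
    refine ih (G.reach (S \ {x}) y \ {y}) b y x e z
      ((Set.ncard_le_ncard Set.sdiff_subset (Set.toFinite _)).trans (hcomp y hy)) hby hxy.symm hxe
      hbe.symm hxb.symm (hne heS hyS) (fun h => hout y hy b (.inl hb) h.1) (fun h => h.2 rfl)
      (fun h => hout y hy x (.inr rfl) h.1) (fun h => hout y hy e (.inl heS) h.1) ?_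
      ⟨hz, hyz.ne'⟩ hyz hez
    intro s hs t hst
    by_cases hty : t = y
    · exact .inr (.inr (.inl hty))
    · rcases hN s hs.1 t hst with h | h | h | h
      exacts [.inl ⟨h, hty⟩, by simp [h], by simp [h], by simp [h]]

/-- If no two vertices of a planar graph have exactly two common neighbours, then the graph has no
4-cycle. -/
lemma IsPlanar.ncard_commonNeighbors_le_one [Finite V] (hG : G.IsPlanar)
    (h2 : ∀ a b, a ≠ b → (G.commonNeighbors a b).ncard ≠ 2) {a b : V} (hab : a ≠ b) :
    (G.commonNeighbors a b).ncard ≤ 1 := by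
  have third : ∀ a b x y, a ≠ b → x ≠ y → G.Adj a x → G.Adj b x → G.Adj a y → G.Adj b y →
      ∃ z, z ≠ x ∧ z ≠ y ∧ G.Adj a z ∧ G.Adj b z := by
    intro a b x y hab hxy hax hbx hay hby
    by_contra! hcon
    apply h2 a b hab
    rw [← Set.ncard_pair hxy]
    congr 1
    ext z
    rw [mem_commonNeighbors]
    constructor
    · rintro ⟨h1, h2⟩
      by_contra hz
      simp only [Set.mem_insert_iff, Set.mem_singleton_iff, not_or] at hz
      exact hcon z hz.1 hz.2 h1 h2
    · rintro (rfl | rfl)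
      exacts [⟨hax, hbx⟩, ⟨hay, hby⟩]
  by_contra! hcon
  obtain ⟨w, hw, w', hw', hww⟩ := (Set.one_lt_ncard (Set.toFinite _)).1 hcon
  obtain ⟨x, hxa, hxb, hx1, hx2⟩ := third w w' a b hww hab hw.1.symm hw'.1.symm hw.2.symm hw'.2.symm
  refine hG.false_of_third_commonNeighbor third _ ({a, w, b, w'}ᶜ) a w b w' x le_rfl hw.1
    hw.2.symm hw'.2 hw'.1.symm hab hww (by simp) (by simp) (by simp) (by simp) ?_ ?_ hx1 hx2
  · intro s _ t _
    by_cases h : t ∈ ({a, w, b, w'} : Set V)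
    · exact .inr (by simpa using h)
    · exact .inl h
  · simp [hxa, hxb, hx1.ne', hx2.ne']

lemma IsKConnected.exists_adj_ne_ne [Fintype V] (hG : G.IsKConnected 3) {v u w : V} (hu : v ≠ u)
    (hw : v ≠ w) : ∃ s, G.Adj v s ∧ s ≠ u ∧ s ≠ w := by
  by_contra! hcon
  classical
  obtain ⟨t, ht⟩ : ∃ t, t ∉ ({v, u, w} : Finset V) := by
    by_contra! h
    have h1 := hG.1
    have h2 : Fintype.card V ≤ ({v, u, w} : Finset V).card :=
      Finset.card_le_card fun t _ => h t
    have := Finset.card_le_three (a := v) (b := u) (c := w)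
    omega
  simp only [Finset.mem_insert, Finset.mem_singleton, not_or] at ht
  have := hG.mem_of_closed (R := {v}) (u := u) (v := w) (t := t) rfl hu hw ?_ ht.2.1 ht.2.2
  · exact ht.1 this
  · rintro a rfl b _ _ hab hbu hbw
    exact absurd (hcon b hab hbu) hbw

/-- The friendship theorem for polyhedra: there are none in which every two vertices have exactly
one common neighbour. -/
lemma IsPolyhedron.not_forall_existsUnique_commonNeighbor [Fintype V] (hG : G.IsPolyhedron)
    (hex : ∀ a b, a ≠ b → ∃ x, G.Adj a x ∧ G.Adj b x)
    (huniq : ∀ a b x y, a ≠ b → G.Adj a x → G.Adj b x → G.Adj a y → G.Adj b y → x = y) :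
    False := by
  obtain ⟨hP, hC⟩ := hG
  have : Nonempty V := Fintype.card_pos_iff.1 (by have := hC.1; omega)
  obtain ⟨v⟩ := this
  have : Nontrivial V := Fintype.one_lt_card_iff_nontrivial.1 (by have := hC.1; omega)
  obtain ⟨v₀, hv₀⟩ := exists_ne v
  obtain ⟨a, hva, -⟩ := hC.exists_adj_ne_ne hv₀.symm hv₀.symm
  obtain ⟨a', hva', haa'⟩ := hex v a hva.ne
  obtain ⟨b, hvb, hba, hba'⟩ := hC.exists_adj_ne_ne hva.ne hva'.ne
  obtain ⟨b', hvb', hbb'⟩ := hex v b hvb.ne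
  have hb'a : b' ≠ a := fun h =>
    hba' (huniq v a _ _ hva.ne hvb (h ▸ hbb'.symm) hva' haa')
  have hb'a' : b' ≠ a' := fun h =>
    hba (huniq v a' _ _ hva'.ne hvb (h ▸ hbb'.symm) hva haa'.symm)
  let S : V → Set V := fun p => {s | s = p ∨ G.Adj p s ∧ s ≠ v ∧ ¬ G.Adj v s}
  have hself : ∀ p, p ∈ S p := fun p => .inl rfl
  have hSc : ∀ p, (G.induce (S p)).Connected := by
    intro p
    refine connected_induce_of_reach (hself p) ?_
    intro s hs
    rcases hs with rfl | h
    · exact mem_reach_self _ _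
    · exact mem_reach_of_adj (mem_reach_self _ _) h.1 (.inr h)
  have hSd : ∀ p q, G.Adj v p → G.Adj v q → p ≠ q → Disjoint (S p) (S q) := by
    intro p q hp hq hpq
    rw [Set.disjoint_left]
    rintro s (rfl | h1) (h | h2)
    · exact hpq h
    · exact h2.2.2 hp
    · exact h1.2.2 (h ▸ hq)
    · exact hpq (huniq v s p q h1.2.1.symm hp h1.1.symm hq h2.1.symm)
  have hSv : ∀ p, G.Adj v p → Disjoint {v} (S p) := by
    intro p hp
    rw [Set.disjoint_singleton_left]
    rintro (h | h)
    exacts [hp.ne h, h.2.1 rfl]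
  have hvS : ∀ p, G.Adj v p → ∃ x ∈ ({v} : Set V), ∃ y ∈ S p, G.Adj x y :=
    fun p hp => ⟨v, rfl, p, hself p, hp⟩
  have hSS : ∀ p q, G.Adj v p → G.Adj v q → p ≠ q → ∃ x ∈ S p, ∃ y ∈ S q, G.Adj x y := by
    intro p q hp hq hpq
    by_cases hadj : G.Adj p q
    · exact ⟨p, hself p, q, hself q, hadj⟩
    obtain ⟨p', hvp', hpp'⟩ := hex v p hp.ne
    obtain ⟨s, hps, hsv, hsp'⟩ := hC.exists_adj_ne_ne hp.ne' hpp'.ne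
    have hvs : ¬ G.Adj v s := fun h => hsp' (huniq v p _ _ hp.ne h hps hvp' hpp')
    obtain ⟨t, hst, hqt⟩ := hex s q (fun h => hvs (h ▸ hq))
    refine ⟨s, .inr ⟨hps, hsv, hvs⟩, t, .inr ⟨hqt, fun h => hvs (h ▸ hst.symm), fun h => ?_⟩, hst⟩
    exact hadj (huniq v s p t hsv.symm hp hps.symm h hst ▸ hqt.symm)
  exact hP.false_of_K5 (connected_induce_singleton v) (hSc a) (hSc a') (hSc b) (hSc b')
    (hSv a hva) (hSv a' hva') (hSv b hvb) (hSv b' hvb')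
    (hSd _ _ hva hva' haa'.ne) (hSd _ _ hva hvb hba.symm) (hSd _ _ hva hvb' hb'a.symm)
    (hSd _ _ hva' hvb hba'.symm) (hSd _ _ hva' hvb' hb'a'.symm) (hSd _ _ hvb hvb' hbb'.ne)
    (hvS a hva) (hvS a' hva') (hvS b hvb) (hvS b' hvb')
    (hSS _ _ hva hva' haa'.ne) (hSS _ _ hva hvb hba.symm) (hSS _ _ hva hvb' hb'a.symm)
    (hSS _ _ hva' hvb hba'.symm) (hSS _ _ hva' hvb' hb'a'.symm) (hSS _ _ hvb hvb' hbb'.ne)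

end SimpleGraph

namespace SimpleGraph

variable {V : Type*} {G : SimpleGraph V}

/-- `p 0, …, p n` is a path in `G` with vertices in `B`. -/
structure IsPathIn (G : SimpleGraph V) (B : Set V) (n : ℕ) (p : ℕ → V) : Prop where
  mem : ∀ i ≤ n, p i ∈ B
  inj : ∀ i ≤ n, ∀ j ≤ n, p i = p j → i = j
  adj : ∀ i < n, G.Adj (p i) (p (i + 1))

/-- Reverse the first `j` vertices of a path whose start is adjacent to its vertex `j`. -/
lemma IsPathIn.rotate {B : Set V} {n j : ℕ} {p : ℕ → V} (hp : G.IsPathIn B n p)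
    (hjn : j ≤ n) (h : G.Adj (p 0) (p j)) :
    G.IsPathIn B n (fun t => p (if t < j then j - 1 - t else t)) := by
  refine ⟨fun i hi => hp.mem _ (by grind), fun i hi k hk hik => ?_, fun i hi => ?_⟩
  · have := hp.inj _ (by grind) _ (by grind) hik
    grind
  · rcases lt_trichotomy (i + 1) j with hij | hij | hij
    · have := hp.adj (j - 1 - (i + 1)) (by omega)
      rw [if_pos (by omega), if_pos hij]
      rw [show j - 1 - (i + 1) + 1 = j - 1 - i by omega] at this
      exact this.symm
    · rw [if_pos (by omega), if_neg (by omega), hij, show j - 1 - i = 0 by omega]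
      exact h
    · rw [if_neg (by omega), if_neg (by omega)]
      exact hp.adj i hi

lemma IsPathIn.connected_induce_image_Icc {B : Set V} {n a b : ℕ} {p : ℕ → V}
    (hp : G.IsPathIn B n p) (hab : a ≤ b) (hb : b ≤ n) :
    (G.induce (p '' Set.Icc a b)).Connected := by
  refine connected_induce_of_reach (y := p a) ⟨a, ⟨le_rfl, hab⟩, rfl⟩ ?_
  rintro _ ⟨i, ⟨hai, hib⟩, rfl⟩
  induction i, hai using Nat.le_induction with
  | base => exact mem_reach_self _ _
  | succ i hai ih =>
    exact mem_reach_of_adj (ih (by omega)) (hp.adj i (by omega)) ⟨i + 1, ⟨by omega, hib⟩, rfl⟩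

lemma IsPathIn.disjoint_image {B : Set V} {n : ℕ} {p : ℕ → V} (hp : G.IsPathIn B n p)
    {s t : Set ℕ} (hs : s ⊆ Set.Iic n) (ht : t ⊆ Set.Iic n) (hst : Disjoint s t) :
    Disjoint (p '' s) (p '' t) := by
  rw [Set.disjoint_left] at hst ⊢
  rintro _ ⟨i, hi, rfl⟩ ⟨k, hk, h⟩
  exact hst hi (hp.inj _ (ht hk) _ (hs hi) h ▸ hk)

/-- In a planar graph, the neighbourhood of a vertex contains no nonempty set inducing a subgraph
of minimum degree at least three, as such a subgraph has a `K₄` minor. -/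
lemma IsPlanar.false_of_three_le_degree [Finite V] (hG : G.IsPlanar) {u : V} {B : Set V}
    (hne : B.Nonempty) (hu : ∀ b ∈ B, G.Adj u b)
    (hdeg : ∀ b ∈ B, 3 ≤ {c ∈ B | G.Adj b c}.ncard) : False := by
  classical
  have hfin : ∀ n, (∃ p, G.IsPathIn B n p) → n ≤ Nat.card V := by
    rintro n ⟨p, hp⟩
    have h : Function.Injective (fun i : Fin n => p i) := fun i k hik =>
      Fin.ext (hp.inj _ i.2.le _ k.2.le hik)
    simpa using Nat.card_le_card_of_injective _ h
  obtain ⟨b₀, hb₀⟩ := hne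
  have h0 : ∃ p, G.IsPathIn B 0 p := ⟨fun _ => b₀, fun _ _ => hb₀, by omega, by omega⟩
  obtain ⟨n, hn, hmax⟩ : ∃ n, (∃ p, G.IsPathIn B n p) ∧ ¬ ∃ p, G.IsPathIn B (n + 1) p := by
    by_contra! hcon
    have hall : ∀ n, ∃ p, G.IsPathIn B n p := fun n => by
      induction n with
      | zero => exact h0
      | succ n ih => exact hcon n ih
    have := hfin _ (hall (Nat.card V + 1))
    omega
  have hend : ∀ p, G.IsPathIn B n p → ∀ c ∈ B, G.Adj (p 0) c → ∃ i, 1 ≤ i ∧ i ≤ n ∧ c = p i := by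
    intro p hp c hc hadj
    by_contra! hcon
    refine hmax ⟨fun i => if i = 0 then c else p (i - 1), fun i hi => ?_, fun i hi k hk hik => ?_,
      fun i hi => ?_⟩
    · split_ifs
      exacts [hc, hp.mem _ (by omega)]
    · have hc' : ∀ i ≤ n, c ≠ p i := fun i hi h => by
        rcases Nat.eq_zero_or_pos i with rfl | hi0
        exacts [hadj.ne h.symm, hcon i hi0 hi h]
      split_ifs at hik with h1 h2 h2
      · omega
      · exact absurd hik (hc' _ (by omega))
      · exact absurd hik.symm (hc' _ (by omega))
      · have := hp.inj _ (by omega) _ (by omega) hik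
        omega
    · rcases Nat.eq_zero_or_pos i with rfl | hi0
      · simpa using hadj.symm
      · have := hp.adj (i - 1) (by omega)
        rw [show i - 1 + 1 = i by omega] at this
        simpa [show i ≠ 0 by omega] using this
  have hfar : ∀ p, G.IsPathIn B n p → ∀ j, ∃ k, 2 ≤ k ∧ k ≤ n ∧ k ≠ j ∧ G.Adj (p 0) (p k) := by
    intro p hp j
    by_contra! hcon
    have hsub : {c ∈ B | G.Adj (p 0) c} ⊆ {p 1, p j} := by
      rintro c ⟨hc, hadj⟩
      obtain ⟨i, hi, hin, rfl⟩ := hend p hp c hc hadj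
      by_contra h
      simp only [Set.mem_insert_iff, Set.mem_singleton_iff, not_or] at h
      exact hcon i (by by_contra h'; exact h.1 (by rw [show i = 1 by omega])) hin
        (fun h' => h.2 (by rw [h'])) hadj
    have h1 := hdeg _ (hp.mem 0 (by omega))
    have h2 := Set.ncard_le_ncard hsub (Set.toFinite _)
    have h3 : ({p 1, p j} : Set V).ncard ≤ 2 := (Set.ncard_insert_le _ _).trans (by simp)
    omega
  have hJ : ∃ j, ∃ p, G.IsPathIn B n p ∧ 2 ≤ j ∧ j ≤ n ∧ G.Adj (p 0) (p j) := by
    obtain ⟨p, hp⟩ := hn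
    obtain ⟨k, hk, hkn, -, h⟩ := hfar p hp 0
    exact ⟨k, p, hp, hk, hkn, h⟩
  obtain ⟨p, hp, hj, hjn, hpj⟩ := Nat.find_spec hJ
  set j := Nat.find hJ with hjdef
  have hbeyond : ∀ p, G.IsPathIn B n p → ∃ k, j < k ∧ k ≤ n ∧ G.Adj (p 0) (p k) := by
    intro p hp
    obtain ⟨k, hk, hkn, hkj, h⟩ := hfar p hp j
    have := Nat.find_min' hJ ⟨p, hp, hk, hkn, h⟩
    exact ⟨k, by omega, hkn, h⟩
  obtain ⟨k, hk, hkn, hpk⟩ := hbeyond p hp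
  obtain ⟨m, hm, hmn, hpm⟩ := hbeyond _ (hp.rotate hjn hpj)
  rw [if_pos (by omega), if_neg (by omega), Nat.sub_zero] at hpm
  have hIcc : ∀ {a b : ℕ}, b ≤ n → Set.Icc a b ⊆ Set.Iic n := fun hb i hi => hi.2.trans hb
  have hdis : ∀ {a b c d : ℕ}, b < c → b ≤ n → d ≤ n →
      Disjoint (p '' Set.Icc a b) (p '' Set.Icc c d) := fun hbc hb hd =>
    hp.disjoint_image (hIcc hb) (hIcc hd) (Set.disjoint_left.2 fun i hi hi' => by
      have := hi.2; have := hi'.1; omega)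
  have hud : ∀ {a b : ℕ}, b ≤ n → Disjoint {u} (p '' Set.Icc a b) := fun hb => by
    rw [Set.disjoint_singleton_left]
    rintro ⟨i, hi, rfl⟩
    exact (hu _ (hp.mem i (hi.2.trans hb))).ne rfl
  have hua : ∀ {a b : ℕ}, a ≤ b → b ≤ n → ∃ x ∈ ({u} : Set V), ∃ y ∈ p '' Set.Icc a b, G.Adj x y :=
    fun hab hb => ⟨u, rfl, p _, ⟨_, ⟨le_rfl, hab⟩, rfl⟩, hu _ (hp.mem _ (hab.trans hb))⟩
  have hpp : ∀ {a b c d x y : ℕ}, x ∈ Set.Icc a b → y ∈ Set.Icc c d → G.Adj (p x) (p y) →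
      ∃ s ∈ p '' Set.Icc a b, ∃ t ∈ p '' Set.Icc c d, G.Adj s t :=
    fun hx hy h => ⟨_, ⟨_, hx, rfl⟩, _, ⟨_, hy, rfl⟩, h⟩
  have hj1 := hp.adj (j - 1) (by omega)
  rw [show j - 1 + 1 = j by omega] at hj1
  exact hG.false_of_K5 (connected_induce_singleton u)
    (hp.connected_induce_image_Icc (a := 0) (b := 0) le_rfl (by omega))
    (hp.connected_induce_image_Icc (a := 1) (b := j - 1) (by omega) (by omega))
    (hp.connected_induce_image_Icc (a := j) (b := j) le_rfl (by omega))
    (hp.connected_induce_image_Icc (a := j + 1) (b := n) (by omega) le_rfl)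
    (hud (by omega)) (hud (by omega)) (hud (by omega)) (hud (by omega))
    (hdis (by omega) (by omega) (by omega)) (hdis (by omega) (by omega) (by omega))
    (hdis (by omega) (by omega) (by omega)) (hdis (by omega) (by omega) (by omega))
    (hdis (by omega) (by omega) (by omega)) (hdis (by omega) (by omega) (by omega))
    (hua (by omega) (by omega)) (hua (by omega) (by omega)) (hua (by omega) (by omega))
    (hua (by omega) (by omega))
    (hpp (x := 0) (y := 1) (by simp) ⟨by omega, by omega⟩ (hp.adj 0 (by omega)))
    (hpp (x := 0) (y := j) (by simp) (by simp) hpj)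
    (hpp (x := 0) (y := k) (by simp) ⟨by omega, by omega⟩ hpk)
    (hpp (x := j - 1) (y := j) ⟨by omega, by omega⟩ (by simp) hj1)
    (hpp (x := j - 1) (y := m) ⟨by omega, by omega⟩ ⟨by omega, by omega⟩ hpm)
    (hpp (x := j) (y := j + 1) (by simp) ⟨by omega, by omega⟩ (hp.adj j (by omega)))

end SimpleGraph

/-- A polyhedron in which every two vertices have a common neighbour, and never exactly three or
four of them. -/
structure SimpleGraph.IsGapPolyhedron {V : Type*} [Fintype V] (G : SimpleGraph V) : Prop where
  isPolyhedron : G.IsPolyhedron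
  exists_common : ∀ a b, a ≠ b → ∃ x, G.Adj a x ∧ G.Adj b x
  ncard_common : ∀ a b, a ≠ b →
    (G.commonNeighbors a b).ncard ≤ 2 ∨ 5 ≤ (G.commonNeighbors a b).ncard

/-- Two vertices with at least five common neighbours. -/
def SimpleGraph.IsBig {V : Type*} (G : SimpleGraph V) (u v : V) : Prop :=
  u ≠ v ∧ 5 ≤ (G.commonNeighbors u v).ncard

/-- The vertices other than `u`, `v` and their common neighbours. -/
def SimpleGraph.rest {V : Type*} (G : SimpleGraph V) (u v : V) : Set V :=
  {x | x ≠ u ∧ x ≠ v ∧ x ∉ G.commonNeighbors u v}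

/-- The common neighbours of `u` and `v` that can be reached from `p` through `G.rest u v`. -/
def SimpleGraph.links {V : Type*} (G : SimpleGraph V) (u v p : V) : Set V :=
  {w | w ∈ G.commonNeighbors u v ∧ w ≠ p ∧ ∃ c ∈ G.reach (G.rest u v) p, G.Adj c w}

namespace SimpleGraph

variable {V : Type*} {G : SimpleGraph V} {u v : V}

lemma IsBig.symm (h : G.IsBig u v) : G.IsBig v u :=
  ⟨h.1.symm, by rw [commonNeighbors_symm]; exact h.2⟩

lemma rest_comm (u v : V) : G.rest u v = G.rest v u := by
  ext x
  simp only [rest, commonNeighbors_symm G u v, Set.mem_ofPred_eq]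
  tauto

lemma links_comm (u v p : V) : G.links u v p = G.links v u p := by
  simp only [links, commonNeighbors_symm G u v, rest_comm u v]

lemma mem_links {p c w : V} (hw : w ∈ G.commonNeighbors u v) (hwp : w ≠ p)
    (hc : c ∈ G.reach (G.rest u v) p) (h : G.Adj c w) : w ∈ G.links u v p :=
  ⟨hw, hwp, c, hc, h⟩

lemma ne_of_mem_rest {x w : V} (hx : x ∈ G.rest u v) (hw : w ∈ G.commonNeighbors u v) : w ≠ x :=
  fun h => hx.2.2 (h ▸ hw)

lemma ne_left_of_mem_commonNeighbors {w : V} (hw : w ∈ G.commonNeighbors u v) : w ≠ u := hw.1.ne'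

lemma ne_right_of_mem_commonNeighbors {w : V} (hw : w ∈ G.commonNeighbors u v) : w ≠ v := hw.2.ne'

lemma mem_rest_or {x : V} (hxu : x ≠ u) (hxv : x ≠ v) :
    x ∈ G.commonNeighbors u v ∨ x ∈ G.rest u v := by
  by_cases h : x ∈ G.commonNeighbors u v
  exacts [.inl h, .inr ⟨hxu, hxv, h⟩]

/-- Two common neighbours linked to the same remaining vertex are linked to each other. -/
lemma mem_links_of_mem_links {x k k' : V} (hx : x ∈ G.rest u v) (hk : k ∈ G.links u v x)
    (hk' : k' ∈ G.links u v x) (hne : k' ≠ k) : k' ∈ G.links u v k := by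
  obtain ⟨_, _, c, hc, hck⟩ := hk
  obtain ⟨hw', _, c', hc', hck'⟩ := hk'
  refine ⟨hw', hne, c', ?_, hck'⟩
  exact reach_trans (mem_reach_of_adj (mem_reach_self _ _) hck.symm (reach_subset hx hc))
    (reach_trans (reach_symm hx hc) hc')

lemma exists_adj_of_mem_reach {w c : V} (h : c ∈ G.reach (G.rest u v) w) (hcw : c ≠ w) :
    c ∈ G.rest u v ∧ ∃ d ∈ G.rest u v, d ∈ G.reach (G.rest u v) c ∧ G.Adj w d := by
  rcases Relation.ReflTransGen.cases_head h with h | ⟨d, hd, hdc⟩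
  · exact absurd h.symm hcw
  · exact ⟨reach_subset hd.2 hdc, d, hd.2, reach_symm hd.2 hdc, hd.1⟩

lemma mem_links_symm {a b : V} (ha : a ∈ G.commonNeighbors u v) (h : b ∈ G.links u v a) :
    a ∈ G.links u v b := by
  obtain ⟨_, hba, c, hc, hcb⟩ := h
  by_cases hca : c = a
  · exact mem_links ha hba.symm (mem_reach_self _ _) (hca ▸ hcb.symm)
  · obtain ⟨hcX, d, _, hdc, hwd⟩ := exists_adj_of_mem_reach hc hca
    exact mem_links ha hba.symm
      (reach_trans (mem_reach_of_adj (mem_reach_self _ _) hcb.symm hcX) hdc) hwd.symm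

lemma IsPlanar.not_three_links (hG : G.IsPlanar) (huv : u ≠ v) {p : V} (hpu : p ≠ u) (hpv : p ≠ v)
    {a b c : V} (ha : a ∈ G.links u v p) (hb : b ∈ G.links u v p) (hc : c ∈ G.links u v p)
    (hab : a ≠ b) (hac : a ≠ c) (hbc : b ≠ c) : False := by
  have hW : ∀ {w}, w ∈ G.links u v p → w ∉ G.reach (G.rest u v) p := by
    intro w hw h
    rcases eq_or_mem_of_mem_reach h with h | h
    exacts [hw.2.1 h, h.2.2 hw.1]
  have hu : u ∉ G.reach (G.rest u v) p := fun h => by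
    rcases eq_or_mem_of_mem_reach h with h | h
    exacts [hpu h.symm, h.1 rfl]
  have hv : v ∉ G.reach (G.rest u v) p := fun h => by
    rcases eq_or_mem_of_mem_reach h with h | h
    exacts [hpv h.symm, h.2.1 rfl]
  exact hG.false_of_K33 (connected_induce_reach _ p) huv hab hac hbc hu hv (hW ha) (hW hb) (hW hc)
    ha.1.1 hb.1.1 hc.1.1 ha.1.2 hb.1.2 hc.1.2 ha.2.2 hb.2.2 hc.2.2

lemma exists_three_of_five_le [Finite V] {W L : Set V} (hW : 5 ≤ W.ncard) (hL : L.ncard ≤ 2) :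
    ∃ a b c, (a ∈ W ∧ a ∉ L) ∧ (b ∈ W ∧ b ∉ L) ∧ (c ∈ W ∧ c ∉ L) ∧ a ≠ b ∧ a ≠ c ∧ b ≠ c := by
  have h : 2 < (W \ L).ncard := by
    have := Set.ncard_le_ncard_sdiff_add_ncard W L (Set.toFinite _)
    omega
  exact (Set.two_lt_ncard_iff (Set.toFinite _)).1 h

lemma IsPlanar.ncard_links_le_two [Finite V] (hG : G.IsPlanar) (huv : u ≠ v) {p : V} (hpu : p ≠ u)
    (hpv : p ≠ v) : (G.links u v p).ncard ≤ 2 := by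
  by_contra! h
  obtain ⟨a, b, c, ha, hb, hc, hab, hac, hbc⟩ := (Set.two_lt_ncard_iff (Set.toFinite _)).1 h
  exact hG.not_three_links huv hpu hpv ha hb hc hab hac hbc

variable [Fintype V]

lemma IsGapPolyhedron.adj_or_adj (hG : G.IsGapPolyhedron) (h : G.IsBig u v) {x : V} (hxu : x ≠ u)
    (hxv : x ≠ v) : G.Adj u x ∨ G.Adj v x := by
  by_contra! hcon
  have hP := hG.isPolyhedron.1
  have hx : x ∈ G.rest u v := ⟨hxu, hxv, fun hw => hcon.1 hw.1⟩
  obtain ⟨a, b, c, ha, hb, hc, hab, hac, hbc⟩ :=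
    exists_three_of_five_le h.2 (hP.ncard_links_le_two h.1 hxu hxv)
  have key : ∀ w, (w ∈ G.commonNeighbors u v ∧ w ∉ G.links u v x) →
      ∃ z ∈ G.links u v x, G.Adj z w := by
    rintro w ⟨hw, hwl⟩
    obtain ⟨z, hwz, hxz⟩ := hG.exists_common w x (ne_of_mem_rest hx hw)
    have hzu : z ≠ u := fun e => hcon.1 (e ▸ hxz.symm)
    have hzv : z ≠ v := fun e => hcon.2 (e ▸ hxz.symm)
    rcases mem_rest_or hzu hzv with hz | hz
    · exact ⟨z, mem_links hz hxz.ne' (mem_reach_self _ _) hxz, hwz.symm⟩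
    · exact absurd (mem_links hw (ne_of_mem_rest hx hw)
        (mem_reach_of_adj (mem_reach_self _ _) hxz hz) hwz.symm) hwl
  have hlink : ∀ w k, (w ∈ G.commonNeighbors u v ∧ w ∉ G.links u v x) → k ∈ G.links u v x →
      G.Adj k w → w ∈ G.links u v k := fun w k hw _ hkw =>
    mem_links hw.1 hkw.ne' (mem_reach_self _ _) hkw
  have htwo : ∀ w w' k k', (w ∈ G.commonNeighbors u v ∧ w ∉ G.links u v x) →
      (w' ∈ G.commonNeighbors u v ∧ w' ∉ G.links u v x) → w ≠ w' → k ∈ G.links u v x →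
      k' ∈ G.links u v x → k' ≠ k → G.Adj k w → G.Adj k w' → False := by
    intro w w' k k' hw hw' hww hk hk' hkk h1 h2
    exact hP.not_three_links h.1 hk.1.1.ne' hk.1.2.ne' (hlink w k hw hk h1) (hlink w' k hw' hk h2)
      (mem_links_of_mem_links hx hk hk' hkk) hww (fun e => hw.2 (e ▸ hk'))
      (fun e => hw'.2 (e ▸ hk'))
  obtain ⟨za, hza, haz⟩ := key a ha
  obtain ⟨zb, hzb, hbz⟩ := key b hb
  obtain ⟨zc, hzc, hcz⟩ := key c hc
  by_cases h1 : za = zb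
  · subst h1
    by_cases h2 : zc = za
    · subst h2
      exact hP.not_three_links h.1 hza.1.1.ne' hza.1.2.ne' (hlink a _ ha hza haz)
        (hlink b _ hb hza hbz) (hlink c _ hc hza hcz) hab hac hbc
    · exact htwo a b za zc ha hb hab hza hzc h2 haz hbz
  by_cases h2 : za = zc
  · subst h2
    exact htwo a c za zb ha hc hac hza hzb (Ne.symm h1) haz hcz
  by_cases h3 : zb = zc
  · subst h3
    exact htwo b c zb za hb hc hbc hzb hza h1 hbz hcz
  · exact hP.not_three_links h.1 hxu hxv hza hzb hzc h1 h2 h3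

lemma IsGapPolyhedron.isBig_of_three (hG : G.IsGapPolyhedron) {a b x y z : V} (hab : a ≠ b)
    (hx : x ∈ G.commonNeighbors a b) (hy : y ∈ G.commonNeighbors a b)
    (hz : z ∈ G.commonNeighbors a b) (hxy : x ≠ y) (hxz : x ≠ z) (hyz : y ≠ z) :
    G.IsBig a b := by
  have := (Set.two_lt_ncard_iff (Set.toFinite _)).2 ⟨x, y, z, hx, hy, hz, hxy, hxz, hyz⟩
  have h := hG.ncard_common a b hab
  exact ⟨hab, by omega⟩

/-- Apart from `u` and `v`, a vertex has at most one neighbour among their common neighbours. -/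
lemma IsGapPolyhedron.eq_of_adj (hG : G.IsGapPolyhedron) (h : G.IsBig u v) {w w' z : V}
    (hw : w ∈ G.commonNeighbors u v) (hw' : w' ∈ G.commonNeighbors u v) (hzu : z ≠ u)
    (hzv : z ≠ v) (hzw : G.Adj z w) (hzw' : G.Adj z w') : w = w' := by
  by_contra hne
  have hP := hG.isPolyhedron.1
  have hbig : G.IsBig w w' := hG.isBig_of_three hne (x := u) (y := v) (z := z)
    ⟨hw.1.symm, hw'.1.symm⟩ ⟨hw.2.symm, hw'.2.symm⟩ ⟨hzw.symm, hzw'.symm⟩ h.1 hzu.symm hzv.symm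
  obtain ⟨a, b, c, ha, hb, hc, hab, hac, hbc⟩ := exists_three_of_five_le hbig.2
    (L := {u, v}) ((Set.ncard_insert_le _ _).trans (by simp))
  simp only [Set.mem_insert_iff, Set.mem_singleton_iff, not_or] at ha hb hc
  obtain ⟨⟨ha1, ha2⟩, hau, hav⟩ := ha
  obtain ⟨⟨hb1, hb2⟩, hbu, hbv⟩ := hb
  obtain ⟨⟨hc1, hc2⟩, hcu, hcv⟩ := hc
  by_cases hex : ∃ t ∈ G.commonNeighbors u v, t ∉ ({w, w', a, b, c} : Set V)
  · obtain ⟨t, ht, hts⟩ := hex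
    simp only [Set.mem_insert_iff, Set.mem_singleton_iff, not_or] at hts
    have htouch : ∀ s, s ≠ u → s ≠ v → ∃ c ∈ ({u, t, v} : Set V), G.Adj c s := by
      intro s hsu hsv
      rcases hG.adj_or_adj h hsu hsv with h1 | h1
      exacts [⟨u, by simp, h1⟩, ⟨v, by simp, h1⟩]
    refine hP.false_of_K33 (connected_induce_triple ht.1 ht.2.symm) hne hab hac hbc ?_ ?_ ?_ ?_ ?_
      ha1 hb1 hc1 ha2 hb2 hc2 (htouch a hau hav) (htouch b hbu hbv) (htouch c hcu hcv)
    · simp [hw.1.ne', hw.2.ne', Ne.symm hts.1]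
    · simp [hw'.1.ne', hw'.2.ne', Ne.symm hts.2.1]
    · simp [hau, hav, Ne.symm hts.2.2.1]
    · simp [hbu, hbv, Ne.symm hts.2.2.2.1]
    · simp [hcu, hcv, Ne.symm hts.2.2.2.2]
  · push Not at hex
    have hsub : G.commonNeighbors u v ⊆ {w, w', a, b, c} := hex
    have hcard : ({w, w', a, b, c} : Set V).ncard ≤ 5 := by
      have h1 := Set.ncard_insert_le w {w', a, b, c}
      have h2 := Set.ncard_insert_le w' {a, b, c}
      have h3 := Set.ncard_insert_le a {b, c}
      have h4 := Set.ncard_insert_le b {c}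
      have h5 := Set.ncard_singleton c
      omega
    have heq := Set.eq_of_subset_of_ncard_le hsub (hcard.trans h.2) (Set.toFinite _)
    have hu : ∀ s ∈ ({w, w', a, b, c} : Set V), G.Adj u s := fun s hs => by
      rw [← heq] at hs
      exact hs.1
    exact hP.false_of_K33 (connected_induce_singleton u) hne hab hac hbc hw.1.ne' hw'.1.ne' hau hbu
      hcu ha1 hb1 hc1 ha2 hb2 hc2 ⟨u, rfl, hu a (by simp)⟩ ⟨u, rfl, hu b (by simp)⟩
      ⟨u, rfl, hu c (by simp)⟩

/-- A remaining neighbour of `u` and a remaining neighbour of `v` have a common neighbour other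
than `u` and `v`. -/
lemma IsGapPolyhedron.exists_adj_or_mem_reach (hG : G.IsGapPolyhedron) {x y : V}
    (hx : x ∈ G.rest u v) (hy : y ∈ G.rest u v) (hxu : G.Adj u x) (hyv : G.Adj v y) :
    (∃ w ∈ G.commonNeighbors u v, G.Adj x w ∧ G.Adj y w) ∨ y ∈ G.reach (G.rest u v) x := by
  obtain ⟨z, hxz, hyz⟩ := hG.exists_common x y (fun e => hx.2.2 ⟨hxu, e ▸ hyv⟩)
  have hzu : z ≠ u := fun e => hy.2.2 ⟨e ▸ hyz.symm, hyv⟩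
  have hzv : z ≠ v := fun e => hx.2.2 ⟨hxu, e ▸ hxz.symm⟩
  rcases mem_rest_or hzu hzv with hz | hz
  · exact .inl ⟨z, hz, hxz, hyz⟩
  · exact .inr (mem_reach_of_adj (mem_reach_of_adj (mem_reach_self _ _) hxz hz) hyz.symm hy)

lemma IsGapPolyhedron.not_adj_right_of_adj_left (hG : G.IsGapPolyhedron) (h : G.IsBig u v)
    {w w₁ w₂ x₁ x₂ y : V} (hw : w ∈ G.commonNeighbors u v) (hw₁ : w₁ ∈ G.commonNeighbors u v)
    (hw₂ : w₂ ∈ G.commonNeighbors u v) (h1 : w₁ ≠ w) (h2 : w₂ ≠ w) (h12 : w₁ ≠ w₂)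
    (hx₁ : x₁ ∈ G.rest u v) (hx₂ : x₂ ∈ G.rest u v) (ha₁ : G.Adj x₁ w₁) (ha₂ : G.Adj x₂ w₂)
    (hl₁ : w ∈ G.links u v x₁) (hu : G.Adj u x₁)
    (hy : y ∈ G.rest u v) (hyw : G.Adj y w) : ¬ G.Adj v y := by
  intro hv
  have hP := hG.isPolyhedron.1
  have hsep : x₂ ∉ G.reach (G.rest u v) x₁ := fun hr =>
    hP.not_three_links h.1 hx₁.1 hx₁.2.1 hl₁
      (mem_links hw₁ (ne_of_mem_rest hx₁ hw₁) (mem_reach_self _ _) ha₁)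
      (mem_links hw₂ (ne_of_mem_rest hx₁ hw₂) hr ha₂) h1.symm h2.symm h12
  have huniq : ∀ {x a b}, x ∈ G.rest u v → a ∈ G.commonNeighbors u v →
      b ∈ G.commonNeighbors u v → G.Adj x a → G.Adj x b → a = b := fun hx ha hb hxa hxb =>
    hG.eq_of_adj h ha hb hx.1 hx.2.1 hxa hxb
  have hu₂ : G.Adj u x₂ := by
    rcases hG.adj_or_adj h hx₂.1 hx₂.2.1 with h3 | h3
    · exact h3
    · rcases hG.exists_adj_or_mem_reach hx₁ hx₂ hu h3 with ⟨b, hb, hb1, hb2⟩ | hr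
      · exact absurd ((huniq hx₁ hw₁ hb ha₁ hb1).trans (huniq hx₂ hw₂ hb ha₂ hb2).symm) h12
      · exact absurd hr hsep
  have hr : ∀ {x a}, x ∈ G.rest u v → a ∈ G.commonNeighbors u v → a ≠ w → G.Adj x a →
      G.Adj u x → y ∈ G.reach (G.rest u v) x := by
    intro x a hx ha haw hxa hux
    rcases hG.exists_adj_or_mem_reach hx hy hux hv with ⟨b, hb, hb1, hb2⟩ | hr
    · exact absurd ((huniq hx ha hb hxa hb1).trans (huniq hy hw hb hyw hb2).symm) haw
    · exact hr
  exact hsep (reach_trans (hr hx₁ hw₁ h1 ha₁ hu) (reach_symm hx₂ (hr hx₂ hw₂ h2 ha₂ hu₂)))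

/-- If a common neighbour `w` of `u` and `v` is linked to two others by different components of the
remaining graph, then its remaining neighbours are all adjacent to `u` or all adjacent to `v`. -/
lemma IsGapPolyhedron.not_adj_left_and_adj_right (hG : G.IsGapPolyhedron) (h : G.IsBig u v)
    {w w₁ w₂ x₁ x₂ x y : V} (hw : w ∈ G.commonNeighbors u v) (hw₁ : w₁ ∈ G.commonNeighbors u v)
    (hw₂ : w₂ ∈ G.commonNeighbors u v) (h1 : w₁ ≠ w) (h2 : w₂ ≠ w) (h12 : w₁ ≠ w₂)
    (hx₁ : x₁ ∈ G.rest u v) (hx₂ : x₂ ∈ G.rest u v) (ha₁ : G.Adj x₁ w₁) (ha₂ : G.Adj x₂ w₂)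
    (hl₁ : w ∈ G.links u v x₁)
    (hx : x ∈ G.rest u v) (hxw : G.Adj x w) (hux : G.Adj u x)
    (hy : y ∈ G.rest u v) (hyw : G.Adj y w) (hvy : G.Adj v y) : False := by
  rcases hG.adj_or_adj h hx₁.1 hx₁.2.1 with hu | hv
  · exact hG.not_adj_right_of_adj_left h hw hw₁ hw₂ h1 h2 h12 hx₁ hx₂ ha₁ ha₂ hl₁ hu hy hyw hvy
  · rw [commonNeighbors_symm] at hw hw₁ hw₂
    rw [rest_comm] at hx₁ hx₂ hx
    rw [links_comm] at hl₁
    exact hG.not_adj_right_of_adj_left h.symm hw hw₁ hw₂ h1 h2 h12 hx₁ hx₂ ha₁ ha₂ hl₁ hv hx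
      hxw hux

end SimpleGraph

namespace SimpleGraph

variable {V : Type*} {G : SimpleGraph V} {u v : V} [Fintype V]

/-- If `u` and `v` are not adjacent, each of their common neighbours is adjacent to another one. -/
lemma IsGapPolyhedron.exists_adj_mem_commonNeighbors (hG : G.IsGapPolyhedron) (h : G.IsBig u v)
    (huv : ¬ G.Adj u v) {w : V} (hw : w ∈ G.commonNeighbors u v) :
    ∃ m ∈ G.commonNeighbors u v, G.Adj w m := by
  by_contra! hno
  have hwu := ne_left_of_mem_commonNeighbors hw
  have hwv := ne_right_of_mem_commonNeighbors hw
  have hrest : ∀ {z}, G.Adj w z → z ≠ u → z ≠ v → z ∈ G.rest u v := fun hz h1 h2 =>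
    (mem_rest_or h1 h2).resolve_left fun hz' => hno _ hz' hz
  obtain ⟨x, hwx, hux⟩ := hG.exists_common w u hwu
  obtain ⟨y, hwy, hvy⟩ := hG.exists_common w v hwv
  have hx : x ∈ G.rest u v := hrest hwx hux.ne' (fun e => huv (e ▸ hux))
  have hy : y ∈ G.rest u v := hrest hwy (fun e => huv (e ▸ hvy).symm) hvy.ne'
  have huniq : ∀ {z a b}, z ≠ u → z ≠ v → a ∈ G.commonNeighbors u v →
      b ∈ G.commonNeighbors u v → G.Adj z a → G.Adj z b → a = b := fun h1 h2 ha hb hza hzb =>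
    hG.eq_of_adj h ha hb h1 h2 hza hzb
  have hall : ∀ t ∈ G.rest u v, w ∈ G.links u v t := by
    intro t ht
    have hwt := ne_of_mem_rest ht hw
    rcases hG.adj_or_adj h ht.1 ht.2.1 with hut | hvt
    · rcases hG.exists_adj_or_mem_reach ht hy hut hvy with ⟨b, hb, htb, hyb⟩ | hr
      · have := huniq hy.1 hy.2.1 hw hb hwy.symm hyb
        exact mem_links hw hwt (mem_reach_self _ _) (this ▸ htb)
      · exact mem_links hw hwt hr hwy.symm
    · rcases hG.exists_adj_or_mem_reach hx ht hux hvt with ⟨b, hb, hxb, htb⟩ | hr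
      · have := huniq hx.1 hx.2.1 hw hb hwx.symm hxb
        exact mem_links hw hwt (mem_reach_self _ _) (this ▸ htb)
      · exact mem_links hw hwt (reach_symm hx hr) hwx.symm
  have htwo : ∀ a ∈ G.links u v w, ∀ b ∈ G.links u v w, a = b := by
    have hstep : ∀ a ∈ G.links u v w, ∃ c ∈ G.rest u v, G.Adj c a := by
      rintro a ⟨ha, -, c, hc, hca⟩
      exact ⟨c, (eq_or_mem_of_mem_reach hc).resolve_left fun e => hno a ha (e ▸ hca), hca⟩
    intro a ha b hb
    by_contra hab
    obtain ⟨c, hc, hca⟩ := hstep a ha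
    obtain ⟨d, hd, hdb⟩ := hstep b hb
    exact hG.not_adj_left_and_adj_right h hw ha.1 hb.1 ha.2.1 hb.2.1 hab hc hd hca hdb
      (hall c hc) hx hwx.symm hux hy hwy.symm hvy
  obtain ⟨a, b, c, ha, hb, hc, hab, hac, hbc⟩ := exists_three_of_five_le h.2 (L := {w})
    (by simp)
  simp only [Set.mem_singleton_iff] at ha hb hc
  have hR : ∀ t, t ≠ u → t ≠ v → t ∈ G.rest u v ∪ {w} ∪ G.links u v w ∪
      {m | m ∈ G.commonNeighbors u v ∧ ∃ k ∈ G.links u v w, G.Adj k m} := fun t =>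
    hG.isPolyhedron.2.mem_of_closed (r := w) (by simp) hwu hwv (by
    intro r hr s hru hrv hrs hsu hsv
    rcases mem_rest_or hsu hsv with hs | hs
    swap
    · exact .inl (.inl (.inl hs))
    by_cases hsw : s = w
    · exact .inl (.inl (.inr hsw))
    rcases hr with ((hr | hr) | hr) | ⟨hr, k, hk, hkr⟩
    · exact .inl (.inr (mem_links_of_mem_links hr (hall r hr)
        (mem_links hs (ne_of_mem_rest hr hs) (mem_reach_self _ _) hrs) hsw))
    · rw [Set.mem_singleton_iff] at hr
      exact absurd (hr ▸ hrs) (hno s hs)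
    · exact .inr ⟨hs, r, hr, hrs⟩
    · exact .inl (.inr (huniq hru hrv hk.1 hs hkr.symm hrs ▸ hk)))
  have hmem : ∀ s, s ∈ G.commonNeighbors u v → s ≠ w → s ∈ G.links u v w ∨
      ∃ k ∈ G.links u v w, G.Adj k s := by
    intro s hs hsw
    rcases hR s hs.1.ne' hs.2.ne' with ((h1 | h1) | h1) | h1
    · exact absurd hs h1.2.2
    · exact absurd h1 hsw
    · exact .inl h1
    · exact .inr h1.2
  have hpair : ∀ s t, s ∈ G.commonNeighbors u v → t ∈ G.commonNeighbors u v →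
      (∃ k ∈ G.links u v w, G.Adj k s) → (∃ k ∈ G.links u v w, G.Adj k t) → s = t := by
    rintro s t hs ht ⟨k, hk, hks⟩ ⟨k', hk', hkt⟩
    rw [htwo k' hk' k hk] at hkt
    exact huniq hk.1.1.ne' hk.1.2.ne' hs ht hks hkt
  rcases hmem a ha.1 ha.2 with h1 | h1 <;> rcases hmem b hb.1 hb.2 with h2 | h2 <;>
    rcases hmem c hc.1 hc.2 with h3 | h3 <;>
    first
    | exact hab (htwo a h1 b h2)
    | exact hac (htwo a h1 c h3)
    | exact hbc (htwo b h2 c h3)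
    | exact hab (hpair a b ha.1 hb.1 h1 h2)
    | exact hac (hpair a c ha.1 hc.1 h1 h3)
    | exact hbc (hpair b c hb.1 hc.1 h2 h3)

lemma IsGapPolyhedron.even_ncard (hG : G.IsGapPolyhedron) (h : G.IsBig u v)
    (huv : ¬ G.Adj u v) : Even (G.commonNeighbors u v).ncard := by
  classical
  set W := G.commonNeighbors u v
  have hdeg : ∀ w : W, (G.induce W).degree w = 1 := by
    rintro ⟨w, hw⟩
    obtain ⟨m, hm, hwm⟩ := hG.exists_adj_mem_commonNeighbors h huv hw
    rw [← card_neighborFinset_eq_degree, Finset.card_eq_one]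
    refine ⟨⟨m, hm⟩, ?_⟩
    ext ⟨t, ht⟩
    simp only [mem_neighborFinset, Finset.mem_singleton, Subtype.mk.injEq, comap_adj,
      Function.Embedding.subtype_apply]
    refine ⟨fun hwt => ?_, fun e => e ▸ hwm⟩
    exact hG.eq_of_adj h ht hm (ne_left_of_mem_commonNeighbors hw)
      (ne_right_of_mem_commonNeighbors hw) hwt hwm
  have hsum := (G.induce W).sum_degrees_eq_twice_card_edges
  rw [Finset.sum_congr rfl (fun w _ => hdeg w)] at hsum
  simp only [Finset.sum_const, smul_eq_mul, mul_one, Finset.card_univ] at hsum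
  rw [← Nat.card_coe_set_eq, Nat.card_eq_fintype_card, hsum]
  exact even_two_mul _

lemma IsGapPolyhedron.false_of_disjoint (hG : G.IsGapPolyhedron) (h : G.IsBig u v) {p q : V}
    (h' : G.IsBig p q) (hpu : p ≠ u) (hpv : p ≠ v) (hqu : q ≠ u) (hqv : q ≠ v) : False := by
  obtain ⟨a, b, c, ha, hb, hc, hab, hac, hbc⟩ := exists_three_of_five_le h.2
    (L := {p, q}) ((Set.ncard_insert_le _ _).trans (by simp))
  simp only [Set.mem_insert_iff, Set.mem_singleton_iff, not_or] at ha hb hc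
  have hp : ∀ {s t}, s ∈ G.commonNeighbors u v → t ∈ G.commonNeighbors u v → G.Adj p s →
      G.Adj p t → s = t := fun hs ht => hG.eq_of_adj h hs ht hpu hpv
  have hq : ∀ {s t}, s ∈ G.commonNeighbors u v → t ∈ G.commonNeighbors u v → G.Adj q s →
      G.Adj q t → s = t := fun hs ht => hG.eq_of_adj h hs ht hqu hqv
  have h1 := hG.adj_or_adj h' ha.2.1 ha.2.2
  have h2 := hG.adj_or_adj h' hb.2.1 hb.2.2
  have h3 := hG.adj_or_adj h' hc.2.1 hc.2.2
  grind

lemma IsGapPolyhedron.false_of_not_adj (hG : G.IsGapPolyhedron) (h : G.IsBig u v) {q : V}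
    (h' : G.IsBig u q) (huq : ¬ G.Adj u q) (hvq : v ≠ q) : False := by
  have hP := hG.isPolyhedron.1
  have hvq' : G.Adj v q := (hG.adj_or_adj h h'.1.symm hvq.symm).resolve_left huq
  have hq : q ∈ G.rest u v := ⟨h'.1.symm, hvq.symm, fun hw => huq hw.1⟩
  obtain ⟨a, b, c, ha, hb, hc, hab, hac, hbc⟩ :=
    exists_three_of_five_le h.2 (hP.ncard_links_le_two h.1 hq.1 hq.2.1)
  have hnot : ∀ {w x}, w ∈ G.commonNeighbors u v → w ∉ G.links u v q → x ∈ G.rest u v →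
      ¬ G.Adj w x := by
    intro w x hw hwl hx hwx
    have hr : x ∉ G.reach (G.rest u v) q := fun hr =>
      hwl (mem_links hw (ne_of_mem_rest hq hw) hr hwx.symm)
    have hxq : x ≠ q := fun e => hr (e ▸ mem_reach_self _ _)
    rcases hG.adj_or_adj h' hx.1 hxq with hux | hqx
    · rcases hG.exists_adj_or_mem_reach hx hq hux hvq' with ⟨k, hk, hxk, hqk⟩ | hr'
      · have := hG.eq_of_adj h hw hk hx.1 hx.2.1 hwx.symm hxk
        exact hwl (mem_links hw (ne_of_mem_rest hq hw) (mem_reach_self _ _) (this ▸ hqk))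
      · exact hr (reach_symm hx hr')
    · exact hr (mem_reach_of_adj (mem_reach_self _ _) hqx hx)
  have key : ∀ w, (w ∈ G.commonNeighbors u v ∧ w ∉ G.links u v q) →
      ∃ m ∈ G.links u v q, G.Adj m w := by
    rintro w ⟨hw, hwl⟩
    by_contra! hcon
    have := hG.isPolyhedron.2.mem_of_closed (u := u) (v := v) (r := w) (t := q)
      (R := {w} ∪ {m | m ∈ G.commonNeighbors u v ∧ G.Adj m w}) (by simp)
      (ne_left_of_mem_commonNeighbors hw) (ne_right_of_mem_commonNeighbors hw) (by
        rintro r hr s hru hrv hrs hsu hsv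
        rcases hr with rfl | ⟨hr, hrw⟩
        · rcases mem_rest_or hsu hsv with hs | hs
          · exact .inr ⟨hs, hrs.symm⟩
          · exact absurd hrs (hnot hw hwl hs)
        · rcases mem_rest_or hsu hsv with hs | hs
          · exact .inl (hG.eq_of_adj h hs hw hru hrv hrs hrw)
          · exact absurd hrs (hnot hr (fun hl => hcon r hl hrw) hs)) hq.1 hq.2.1
    rcases this with e | e
    · exact ne_of_mem_rest hq hw e.symm
    · exact hq.2.2 e.1
  obtain ⟨ka, hka, haa⟩ := key a ha
  obtain ⟨kb, hkb, hbb⟩ := key b hb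
  obtain ⟨kc, hkc, hcc⟩ := key c hc
  have huniq : ∀ {k s t}, k ∈ G.links u v q → s ∈ G.commonNeighbors u v →
      t ∈ G.commonNeighbors u v → G.Adj k s → G.Adj k t → s = t := fun hk hs ht =>
    hG.eq_of_adj h hs ht hk.1.1.ne' hk.1.2.ne'
  exact hP.not_three_links h.1 hq.1 hq.2.1 hka hkb hkc
    (fun e => hab (huniq hka ha.1 hb.1 haa (e ▸ hbb)))
    (fun e => hac (huniq hka ha.1 hc.1 haa (e ▸ hcc)))
    (fun e => hbc (huniq hkb hb.1 hc.1 hbb (e ▸ hcc)))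

end SimpleGraph

namespace SimpleGraph

variable {V : Type*} {G : SimpleGraph V} {u v : V} [Fintype V]

lemma IsGapPolyhedron.isBig_or_isBig_of_adj (hG : G.IsGapPolyhedron) (huv : G.Adj u v) {w x y : V}
    (hw : w ∈ G.commonNeighbors u v) (hxu : x ≠ u) (hxv : x ≠ v) (hyu : y ≠ u) (hyv : y ≠ v)
    (hxy : x ≠ y) (hwx : G.Adj w x) (hwy : G.Adj w y)
    (h : G.Adj u x ∧ G.Adj u y ∨ G.Adj v x ∧ G.Adj v y) : G.IsBig u w ∨ G.IsBig v w := by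
  rcases h with ⟨hx, hy⟩ | ⟨hx, hy⟩
  · exact .inl (hG.isBig_of_three hw.1.ne (x := v) ⟨huv, hw.2.symm⟩ ⟨hx, hwx⟩ ⟨hy, hwy⟩
      hxv.symm hyv.symm hxy)
  · exact .inr (hG.isBig_of_three hw.2.ne (x := u) ⟨huv.symm, hw.1.symm⟩ ⟨hx, hwx⟩ ⟨hy, hwy⟩
      hxu.symm hyu.symm hxy)

lemma IsGapPolyhedron.isBig_or_isBig_of_adj_of_mem_links (hG : G.IsGapPolyhedron)
    (h : G.IsBig u v) (huv : G.Adj u v) {w w₁ w₂ : V} (hw : w ∈ G.commonNeighbors u v)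
    (hw₁ : w₁ ∈ G.commonNeighbors u v) (hw₂ : w₂ ∈ G.links u v w) (h12 : w₁ ≠ w₂)
    (hww₁ : G.Adj w w₁) : G.IsBig u w ∨ G.IsBig v w := by
  obtain ⟨hw₂', -, c, hc, hcw₂⟩ := hw₂
  have hcw : c ≠ w := by
    rintro rfl
    exact h12 (hG.eq_of_adj h hw₁ hw₂' hw.1.ne' hw.2.ne' hww₁ hcw₂)
  obtain ⟨-, d, hd, -, hwd⟩ := exists_adj_of_mem_reach hc hcw
  refine hG.isBig_or_isBig_of_adj huv hw hw₁.1.ne' hw₁.2.ne' hd.1 hd.2.1 (ne_of_mem_rest hd hw₁)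
    hww₁ hwd ?_
  exact (hG.adj_or_adj h hd.1 hd.2.1).imp (⟨hw₁.1, ·⟩) (⟨hw₁.2, ·⟩)

lemma IsGapPolyhedron.isBig_or_isBig_of_mem_links (hG : G.IsGapPolyhedron) (h : G.IsBig u v)
    (huv : G.Adj u v) {w w₁ w₂ : V} (hw : w ∈ G.commonNeighbors u v) (hw₁ : w₁ ∈ G.links u v w)
    (hw₂ : w₂ ∈ G.links u v w) (h12 : w₁ ≠ w₂) : G.IsBig u w ∨ G.IsBig v w := by
  have hl₁ := hw₁
  have hl₂ := hw₂
  obtain ⟨hw₁, hne₁, c₁, hc₁, hcw₁⟩ := hw₁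
  obtain ⟨hw₂, hne₂, c₂, hc₂, hcw₂⟩ := hw₂
  by_cases h1 : c₁ = w
  · exact hG.isBig_or_isBig_of_adj_of_mem_links h huv hw hw₁ hl₂ h12 (h1 ▸ hcw₁)
  by_cases h2 : c₂ = w
  · exact hG.isBig_or_isBig_of_adj_of_mem_links h huv hw hw₂ hl₁ h12.symm (h2 ▸ hcw₂)
  obtain ⟨hX₁, d₁, hd₁, hr₁, hwd₁⟩ := exists_adj_of_mem_reach hc₁ h1
  obtain ⟨hX₂, d₂, hd₂, hr₂, hwd₂⟩ := exists_adj_of_mem_reach hc₂ h2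
  have hl : w ∈ G.links u v c₁ := mem_links hw (ne_of_mem_rest hX₁ hw) hr₁ hwd₁.symm
  have hd : d₁ ≠ d₂ := by
    rintro rfl
    exact hG.isPolyhedron.1.not_three_links h.1 hX₁.1 hX₁.2.1 hl
      (mem_links hw₁ (ne_of_mem_rest hX₁ hw₁) (mem_reach_self _ _) hcw₁)
      (mem_links hw₂ (ne_of_mem_rest hX₁ hw₂) (reach_trans hr₁ (reach_symm hX₂ hr₂)) hcw₂)
      hne₁.symm hne₂.symm h12
  have hmix : ∀ {x y}, x ∈ G.rest u v → y ∈ G.rest u v → G.Adj w x → G.Adj w y → G.Adj u x →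
      G.Adj v y → False := fun hx hy hwx hwy hux hvy =>
    hG.not_adj_left_and_adj_right h hw hw₁ hw₂ hne₁ hne₂ h12 hX₁ hX₂ hcw₁ hcw₂ hl hx hwx.symm hux
      hy hwy.symm hvy
  refine hG.isBig_or_isBig_of_adj huv hw hd₁.1 hd₁.2.1 hd₂.1 hd₂.2.1 hd hwd₁ hwd₂ ?_
  rcases hG.adj_or_adj h hd₁.1 hd₁.2.1 with h3 | h3 <;>
    rcases hG.adj_or_adj h hd₂.1 hd₂.2.1 with h4 | h4
  · exact .inl ⟨h3, h4⟩
  · exact (hmix hd₁ hd₂ hwd₁ hwd₂ h3 h4).elim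
  · exact (hmix hd₂ hd₁ hwd₂ hwd₁ h4 h3).elim
  · exact .inr ⟨h3, h4⟩

/-- The graph on the common neighbours of `u` and `v` given by `SimpleGraph.links`. -/
def linkGraph (G : SimpleGraph V) (u v : V) : SimpleGraph (G.commonNeighbors u v) where
  Adj a b := b.1 ∈ G.links u v a.1
  symm := ⟨fun a _ h => mem_links_symm a.2 h⟩
  loopless := ⟨fun _ h => h.2.1 rfl⟩

lemma IsKConnected.connected_linkGraph (hG : G.IsKConnected 3)
    (hne : (G.commonNeighbors u v).Nonempty) : (G.linkGraph u v).Connected := by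
  obtain ⟨w₀, hw₀⟩ := hne
  have key : ∀ t, t ≠ u → t ≠ v → t ∈
      {s | (∃ hs : s ∈ G.commonNeighbors u v, (G.linkGraph u v).Reachable ⟨w₀, hw₀⟩ ⟨s, hs⟩) ∨
        s ∈ G.rest u v ∧ ∃ t, (G.linkGraph u v).Reachable ⟨w₀, hw₀⟩ t ∧ t.1 ∈ G.links u v s} := by
    refine fun t => hG.mem_of_closed (r := w₀) (.inl ⟨hw₀, Reachable.refl _⟩) hw₀.1.ne' hw₀.2.ne' ?_
    rintro a (⟨ha, hra⟩ | ⟨ha, t, hrt, hta⟩) b - - hab hbu hbv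
    · rcases mem_rest_or hbu hbv with hb | hb
      · refine .inl ⟨hb, hra.trans (Adj.reachable ?_)⟩
        exact mem_links hb hab.ne' (mem_reach_self _ _) hab
      · exact .inr ⟨hb, ⟨a, ha⟩, hra, mem_links ha hab.ne (mem_reach_self _ _) hab.symm⟩
    · rcases mem_rest_or hbu hbv with hb | hb
      · refine .inl ⟨hb, ?_⟩
        by_cases hbt : b = t.1
        · subst hbt
          exact hrt
        · refine hrt.trans (Adj.reachable ?_)
          exact mem_links_of_mem_links ha hta
            (mem_links hb hab.ne' (mem_reach_self _ _) hab) hbt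
      · obtain ⟨ht, -, c, hc, hct⟩ := hta
        exact .inr ⟨hb, t, hrt, mem_links ht (ne_of_mem_rest hb ht)
          (reach_trans (mem_reach_of_adj (mem_reach_self _ _) hab.symm ha) hc) hct⟩
  have hall : ∀ t, (G.linkGraph u v).Reachable ⟨w₀, hw₀⟩ t := by
    rintro ⟨t, ht⟩
    rcases key t ht.1.ne' ht.2.ne' with ⟨_, h⟩ | h
    exacts [h, absurd ht h.1.2.2]
  have : Nonempty (G.commonNeighbors u v) := ⟨⟨w₀, hw₀⟩⟩
  exact ⟨fun a b => (hall a).symm.trans (hall b)⟩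

lemma IsGapPolyhedron.three_le_ncard_isBig (hG : G.IsGapPolyhedron) (h : G.IsBig u v)
    (huv : G.Adj u v) :
    3 ≤ {w | w ∈ G.commonNeighbors u v ∧ (G.IsBig u w ∨ G.IsBig v w)}.ncard := by
  classical
  set M := {w | w ∈ G.commonNeighbors u v ∧ (G.IsBig u w ∨ G.IsBig v w)}
  have hconn : (G.linkGraph u v).Connected := by
    refine hG.isPolyhedron.2.connected_linkGraph (Set.nonempty_of_ncard_ne_zero ?_)
    have := h.2
    omega
  have hcard := hconn.card_vert_le_card_edgeSet_add_one
  have hdeg : ∀ w, (G.linkGraph u v).degree w ≤ 1 + if w.1 ∈ M then 1 else 0 := by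
    intro w
    rw [← card_neighborFinset_eq_degree]
    split_ifs with hwM
    · by_contra! hlt
      obtain ⟨a, b, c, ha, hb, hc, hab, hac, hbc⟩ := Finset.two_lt_card_iff.1 hlt
      rw [mem_neighborFinset] at ha hb hc
      exact hG.isPolyhedron.1.not_three_links h.1 w.2.1.ne' w.2.2.ne' ha hb hc
        (Subtype.coe_ne_coe.2 hab) (Subtype.coe_ne_coe.2 hac) (Subtype.coe_ne_coe.2 hbc)
    · refine Finset.card_le_one.2 fun a ha b hb => ?_
      rw [mem_neighborFinset] at ha hb
      by_contra hab
      exact hwM ⟨w.2, hG.isBig_or_isBig_of_mem_links h huv w.2 ha hb (Subtype.coe_ne_coe.2 hab)⟩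
  have hsum := Finset.sum_le_sum fun w (_ : w ∈ Finset.univ) => hdeg w
  rw [sum_degrees_eq_twice_card_edges, Finset.sum_add_distrib, Finset.sum_const, smul_eq_mul,
    mul_one, Finset.card_univ, ← Finset.card_filter] at hsum
  have hle : (Finset.univ.filter fun w : G.commonNeighbors u v => w.1 ∈ M).card ≤ M.ncard := by
    rw [← Finset.card_map (Function.Embedding.subtype _), ← Set.ncard_coe_finset]
    refine Set.ncard_le_ncard (fun x hx => ?_) (Set.toFinite _)
    obtain ⟨y, hy, rfl⟩ := Finset.mem_map.1 (Finset.mem_coe.1 hx)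
    exact (Finset.mem_filter.1 hy).2
  have h5 := h.2
  rw [← Nat.card_coe_set_eq, Nat.card_eq_fintype_card] at h5
  rw [Nat.card_eq_fintype_card, Nat.card_eq_fintype_card, ← edgeFinset_card] at hcard
  omega

lemma IsGapPolyhedron.false_of_adj_of_isBig (hG : G.IsGapPolyhedron) (h : G.IsBig u v)
    (huv : G.Adj u v) {w : V} (hw : w ∈ G.commonNeighbors u v) (huw : G.IsBig u w) : False := by
  obtain ⟨q, ⟨hq, hqbig⟩, hqw⟩ := Set.exists_ne_of_one_lt_ncard
    (lt_of_lt_of_le (by norm_num) (hG.three_le_ncard_isBig h huv)) w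
  have huq : G.IsBig u q := hqbig.resolve_right fun hvq =>
    hG.false_of_disjoint huw hvq h.1.symm hw.2.ne hq.1.ne' hqw
  have hadj : ∀ b, G.IsBig u b → G.Adj u b := by
    intro b hb
    by_contra hub
    have hbv : b ≠ v := fun e => hub (e ▸ huv)
    have hbw : b ≠ w := fun e => hub (e ▸ hw.1)
    have hbq : b ≠ q := fun e => hub (e ▸ hq.1)
    have h1 := (hG.adj_or_adj huw hb.1.symm hbw).resolve_left hub
    have h2 := (hG.adj_or_adj huq hb.1.symm hbq).resolve_left hub
    exact hqw (hG.eq_of_adj h hq hw hb.1.symm hbv h2.symm h1.symm)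
  refine hG.isPolyhedron.1.false_of_three_le_degree (u := u) (B := {b | G.IsBig u b}) ⟨v, h⟩ hadj
    fun b hb => (hG.three_le_ncard_isBig hb (hadj b hb)).trans
      (Set.ncard_le_ncard ?_ (Set.toFinite _))
  rintro c ⟨hc, hbig⟩
  refine ⟨hbig.elim id fun hbc => ?_, hc.2⟩
  have hdis : ∀ {d}, G.IsBig u d → d = b ∨ d = c := fun hd => by
    by_contra! hne
    exact hG.false_of_disjoint hd hbc hb.1.symm hne.1.symm hc.1.ne' hne.2.symm
  have h1 := hdis h
  have h2 := hdis huw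
  have h3 := hdis huq
  have := hw.2.ne
  have := hq.2.ne
  grind

lemma IsGapPolyhedron.not_adj_of_isBig (hG : G.IsGapPolyhedron) (h : G.IsBig u v) :
    ¬ G.Adj u v := by
  intro huv
  obtain ⟨w, hw, hu | hv⟩ := Set.nonempty_of_ncard_ne_zero
    (Nat.ne_zero_of_lt (hG.three_le_ncard_isBig h huv))
  · exact hG.false_of_adj_of_isBig h huv hw hu
  · exact hG.false_of_adj_of_isBig h.symm huv.symm ⟨hw.2, hw.1⟩ hv

lemma IsGapPolyhedron.ncard_commonNeighbors_eq (hG : G.IsGapPolyhedron) (h : G.IsBig u v) {p q : V}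
    (h' : G.IsBig p q) : (G.commonNeighbors p q).ncard = (G.commonNeighbors u v).ncard := by
  have key : ∀ {a b c}, G.IsBig a b → G.IsBig a c → b = c := fun hb hc => by
    by_contra hne
    exact hG.false_of_not_adj hb hc (hG.not_adj_of_isBig hc) hne
  by_cases hpu : p = u
  · subst hpu
    rw [key h h']
  by_cases hqv : q = v
  · subst hqv
    exact absurd (key h'.symm h.symm) hpu
  by_cases hpv : p = v
  · subst hpv
    rw [key h.symm h', commonNeighbors_symm]
  by_cases hqu : q = u
  · subst hqu
    exact absurd (key h h'.symm).symm hpv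
  · exact (hG.false_of_disjoint h h' hpu hpv hqu hqv).elim

end SimpleGraph

namespace SimpleGraph

variable {V : Type*} {G : SimpleGraph V}

lemma finite_commA [Finite V] : G.commA.Finite := by
  refine (Set.finite_range fun p : V × V => (G.commonNeighbors p.1 p.2).ncard).subset ?_
  rintro _ ⟨u, v, -, rfl⟩
  exact ⟨(u, v), rfl⟩

lemma exists_common_of_zero_notMem_commA [Finite V] (h0 : 0 ∉ G.commA) {a b : V} (hab : a ≠ b) :
    ∃ x, G.Adj a x ∧ G.Adj b x :=
  Set.nonempty_of_ncard_ne_zero fun h => h0 ⟨a, b, hab, h⟩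

lemma IsPlanar.le_one_of_mem_commA [Finite V] (hG : G.IsPlanar) (h2 : 2 ∉ G.commA) {a : ℕ}
    (ha : a ∈ G.commA) : a ≤ 1 := by
  obtain ⟨u, v, huv, rfl⟩ := ha
  exact hG.ncard_commonNeighbors_le_one (fun a b hab h => h2 ⟨a, b, hab, h⟩) huv

lemma IsPolyhedron.zero_mem_commA_or_two_mem_commA [Fintype V] (hG : G.IsPolyhedron) :
    0 ∈ G.commA ∨ 2 ∈ G.commA := by
  by_contra! h
  refine hG.not_forall_existsUnique_commonNeighbor
    (fun a b => exists_common_of_zero_notMem_commA h.1) fun a b x y hab hax hbx hay hby => ?_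
  have hle := hG.1.le_one_of_mem_commA h.2 ⟨a, b, hab, rfl⟩
  exact (Set.ncard_le_one (Set.toFinite _)).1 hle x ⟨hax, hbx⟩ y ⟨hay, hby⟩

lemma IsPolyhedron.isGapPolyhedron [Fintype V] (hG : G.IsPolyhedron) (h0 : 0 ∉ G.commA)
    (h3 : 3 ∉ G.commA) (h4 : 4 ∉ G.commA) : G.IsGapPolyhedron where
  isPolyhedron := hG
  exists_common _ _ := exists_common_of_zero_notMem_commA h0
  ncard_common a b hab := by
    have h3' : (G.commonNeighbors a b).ncard ≠ 3 := fun h => h3 ⟨a, b, hab, h⟩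
    have h4' : (G.commonNeighbors a b).ncard ≠ 4 := fun h => h4 ⟨a, b, hab, h⟩
    omega

/-- If two vertices of a polyhedron always have common neighbours, but never three or four of them,
then at most one number above `4` occurs, and that number is even. -/
lemma IsPolyhedron.commA_eq_of_notMem [Fintype V] (hG : G.IsPolyhedron) (h0 : 0 ∉ G.commA)
    (h1 : 1 ∈ G.commA) (h3 : 3 ∉ G.commA) (h4 : 4 ∉ G.commA) :
    G.commA = {1, 2} ∨ ∃ ℓ : ℕ, Even ℓ ∧ 6 ≤ ℓ ∧ G.commA = {1, 2, ℓ} := by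
  have h2 := hG.zero_mem_commA_or_two_mem_commA.resolve_left h0
  have hgap := hG.isGapPolyhedron h0 h3 h4
  have hcases : ∀ a ∈ G.commA, a = 1 ∨ a = 2 ∨ 5 ≤ a := by
    intro a ha
    have : a ≠ 0 := fun e => h0 (e ▸ ha)
    have : a ≠ 3 := fun e => h3 (e ▸ ha)
    have : a ≠ 4 := fun e => h4 (e ▸ ha)
    omega
  by_cases hbig : ∃ ℓ ∈ G.commA, 5 ≤ ℓ
  · obtain ⟨ℓ, hℓ, h5⟩ := hbig
    obtain ⟨u, v, huv, rfl⟩ := id hℓ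
    have h : G.IsBig u v := ⟨huv, h5⟩
    have heven := hgap.even_ncard h (hgap.not_adj_of_isBig h)
    refine .inr ⟨_, heven, ?_, Set.Subset.antisymm (fun a ha => ?_) ?_⟩
    · obtain ⟨k, hk⟩ := heven
      omega
    · rcases hcases a ha with rfl | rfl | ha5
      · simp
      · simp
      · obtain ⟨p, q, hpq, rfl⟩ := ha
        simp [hgap.ncard_commonNeighbors_eq h ⟨hpq, ha5⟩]
    · rintro a (rfl | rfl | rfl)
      exacts [h1, h2, hℓ]
  · refine .inl (Set.Subset.antisymm (fun a ha => ?_) ?_)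
    · rcases hcases a ha with rfl | rfl | ha5
      · simp
      · simp
      · exact absurd ⟨a, ha, ha5⟩ hbig
    · rintro a (rfl | rfl)
      exacts [h1, h2]

end SimpleGraph

/-- A finite set of naturals containing `T` is either `T`, or the union of `T` and a nonempty
set of other elements. -/
lemma Set.Finite.eq_or_exists_eq_union {A T : Set ℕ} (hA : A.Finite) (hT : T ⊆ A) {n : ℕ}
    (hn : ∀ a ∈ A, a ∉ T → n ≤ a) :
    A = T ∨ ∃ S : Finset ℕ, S.Nonempty ∧ (∀ a ∈ S, n ≤ a) ∧ A = T ∪ (S : Set ℕ) := by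
  rcases (A \ T).eq_empty_or_nonempty with h | h
  · exact .inl ((Set.sdiff_eq_empty.1 h).antisymm hT)
  · refine .inr ⟨(hA.sdiff (t := T)).toFinset, ?_, ?_, ?_⟩
    · simpa using h
    · simpa using hn
    · simp [Set.union_eq_self_of_subset_left hT]

/-- If `G` is a polyhedron with `1 ∈ A(G)`, then `A(G)` is
one of: `{0,1}`; `{0,1,2}`; `{0,1,2} ∪ S₃` (`S₃` finite nonempty, elements
`≥ 3`); `{1,2}`; `{1,2,3}`; `{1,2,3} ∪ S₄` (elements `≥ 4`); `{1,2,4}`;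
`{1,2,4} ∪ S₅` (elements `≥ 5`); or `{1,2,ℓ}` for some even `ℓ ≥ 6`. -/
theorem stmt19 {V : Type*} [Fintype V] (G : SimpleGraph V)
    (hG : G.IsPolyhedron) (h1 : 1 ∈ G.commA) :
    G.commA = {0, 1} ∨
    G.commA = {0, 1, 2} ∨
    (∃ S : Finset ℕ, S.Nonempty ∧ (∀ a ∈ S, 3 ≤ a) ∧
      G.commA = {0, 1, 2} ∪ (S : Set ℕ)) ∨
    G.commA = {1, 2} ∨
    G.commA = {1, 2, 3} ∨
    (∃ S : Finset ℕ, S.Nonempty ∧ (∀ a ∈ S, 4 ≤ a) ∧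
      G.commA = {1, 2, 3} ∪ (S : Set ℕ)) ∨
    G.commA = {1, 2, 4} ∨
    (∃ S : Finset ℕ, S.Nonempty ∧ (∀ a ∈ S, 5 ≤ a) ∧
      G.commA = {1, 2, 4} ∪ (S : Set ℕ)) ∨
    (∃ ℓ : ℕ, Even ℓ ∧ 6 ≤ ℓ ∧ G.commA = {1, 2, ℓ}) := by
  have hfin := G.finite_commA
  by_cases h0 : 0 ∈ G.commA
  · by_cases h2 : 2 ∈ G.commA
    · have := hfin.eq_or_exists_eq_union (T := {0, 1, 2}) (n := 3)
        (by rintro a (rfl | rfl | rfl) <;> assumption) (by simp; omega)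
      exact .inr (this.imp_right .inl)
    · refine .inl (Set.Subset.antisymm (fun a ha => ?_) ?_)
      · have := hG.1.le_one_of_mem_commA h2 ha
        simp only [Set.mem_insert_iff, Set.mem_singleton_iff]
        omega
      · rintro a (rfl | rfl) <;> assumption
  have h2 := hG.zero_mem_commA_or_two_mem_commA.resolve_left h0
  have hpos : ∀ a ∈ G.commA, a ≠ 0 := fun a ha e => h0 (e ▸ ha)
  by_cases h3 : 3 ∈ G.commA
  · have := hfin.eq_or_exists_eq_union (T := {1, 2, 3}) (n := 4)
      (by rintro a (rfl | rfl | rfl) <;> assumption) (fun a ha => by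
        have := hpos a ha
        simp
        omega)
    exact .inr (.inr (.inr (.inr (this.imp_right .inl))))
  by_cases h4 : 4 ∈ G.commA
  · have := hfin.eq_or_exists_eq_union (T := {1, 2, 4}) (n := 5)
      (by rintro a (rfl | rfl | rfl) <;> assumption) (fun a ha => by
        have := hpos a ha
        have : a ≠ 3 := fun e => h3 (e ▸ ha)
        simp
        omega)
    exact .inr (.inr (.inr (.inr (.inr (.inr (this.imp_right .inl))))))
  have := hG.commA_eq_of_notMem h0 h1 h3 h4
  tauto
end
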